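/- Let p : ℕ → (0,1], let C > 0, and let (G_n) be a sequence of graphs with vertex set {1,…,n} whose density is bounded by C. Then there exist a kernel κ : [0,1]² → [0,C] and a strictly increasing sequence (n_i) such that δ_□(G_{n_i}, κ) → 0 as i → ∞; moreover the vertices of each G_{n_i} may be relabelled (i.e. G_{n_i} replaced by an isomorphic graph on {1,…,n_i}) so that ‖κ_{G_{n_i}} − κ‖_□ → 0. -/

import Mathlib

open MeasureTheory Set Filter
open scoped ENNReal Classical

noncomputable section

/-- The (0-based) index of the subinterval `((i)/n, (i+1)/n]` of `[0,1]` containing `x`. -/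
def idx (n : ℕ) (x : ℝ) : ℕ := ⌈x * n⌉₊ - 1

/-- The subset of `[0,1]` corresponding to a set of vertices of a graph on `Fin n`:
the union of the intervals `(i/n, (i+1)/n]` for `i ∈ X` (vertices `0`-indexed). -/
def vtxSet (n : ℕ) (X : Finset (Fin n)) : Set ℝ :=
  ⋃ i ∈ X, Ioc ((i : ℝ) / n) (((i : ℝ) + 1) / n)

/-- The kernel associated to a graph `G` on `{1,…,n}` and normalizing constant `p`:
it takes the value `1/p` on `((i−1)/n, i/n] × ((j−1)/n, j/n]` whenever `ij ∈ E(G)`,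
and `0` elsewhere. -/
def graphKernel {n : ℕ} (p : ℝ) (G : SimpleGraph (Fin n)) : ℝ → ℝ → ℝ := fun x y =>
  if h : x ∈ Ioc (0:ℝ) 1 ∧ y ∈ Ioc (0:ℝ) 1 ∧ idx n x < n ∧ idx n y < n then
    (if G.Adj ⟨idx n x, h.2.2.1⟩ ⟨idx n y, h.2.2.2⟩ then 1 / p else 0)
  else 0

/-- The cut norm of `W : [0,1]² → ℝ`. -/
def cutNorm (W : ℝ → ℝ → ℝ) : ℝ :=
  sSup {r | ∃ S T : Set ℝ, MeasurableSet S ∧ MeasurableSet T ∧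
    S ⊆ Icc 0 1 ∧ T ⊆ Icc 0 1 ∧ r = |∫ q in S ×ˢ T, W q.1 q.2|}

/-- `τ` is a Lebesgue-measure-preserving bijection of `[0,1]`. -/
def MPBij (τ : ℝ → ℝ) : Prop :=
  MeasurePreserving τ (volume.restrict (Icc 0 1)) (volume.restrict (Icc 0 1)) ∧
    BijOn τ (Icc 0 1) (Icc 0 1)

/-- The cut distance between two kernels. -/
def cutDist (κ₁ κ₂ : ℝ → ℝ → ℝ) : ℝ :=
  sInf {r | ∃ τ : ℝ → ℝ, MPBij τ ∧ r = cutNorm (fun x y => κ₁ x y - κ₂ (τ x) (τ y))}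

/-- The number of homomorphisms from `F` to `G`. -/
def homCount {α β : Type*} (F : SimpleGraph α) (G : SimpleGraph β) : ℕ :=
  Nat.card (F →g G)

/-- The number of injective homomorphisms (embeddings) from `F` to `G`. -/
def embCount {α β : Type*} (F : SimpleGraph α) (G : SimpleGraph β) : ℕ :=
  Nat.card {φ : F →g G // Function.Injective φ}

/-- The number of edges of a graph. -/
def edgeCount {α : Type*} (F : SimpleGraph α) : ℕ := Nat.card F.edgeSet

/-- The normalized homomorphism count `t_p(F,G)`. -/
def tDen {α β : Type*} [Fintype α] [Fintype β] (p : ℝ) (F : SimpleGraph α)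
    (G : SimpleGraph β) : ℝ :=
  homCount F G / (p ^ edgeCount F * (Fintype.card β : ℝ) ^ Fintype.card α)

/-- The normalized embedding count `s_p(F,G)`. -/
def sDen {α β : Type*} [Fintype α] [Fintype β] (p : ℝ) (F : SimpleGraph α)
    (G : SimpleGraph β) : ℝ :=
  embCount F G / (p ^ edgeCount F * ((Fintype.card β).descFactorial (Fintype.card α) : ℝ))

/-- The homomorphism density `s(F,κ)` of a finite graph in a kernel. -/
def homDensity {α : Type*} [Fintype α] (F : SimpleGraph α) (κ : ℝ → ℝ → ℝ) : ℝ :=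
  ∫ x in Set.univ.pi (fun _ : α => Icc (0:ℝ) 1),
    ∏ e ∈ F.edgeFinset,
      Sym2.lift ⟨fun i j => (κ (x i) (x j) + κ (x j) (x i)) / 2,
        fun i j => by dsimp only; rw [add_comm (κ (x i) (x j)) (κ (x j) (x i))]⟩ e

/-- The homomorphism density as a lower integral (for possibly unbounded kernels). -/
def homDensityL {α : Type*} [Fintype α] (F : SimpleGraph α) (κ : ℝ → ℝ → ℝ) : ℝ≥0∞ :=
  ∫⁻ x in Set.univ.pi (fun _ : α => Icc (0:ℝ) 1),
    ∏ e ∈ F.edgeFinset,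
      Sym2.lift ⟨fun i j => ENNReal.ofReal ((κ (x i) (x j) + κ (x j) (x i)) / 2),
        fun i j => by dsimp only; rw [add_comm (κ (x i) (x j)) (κ (x j) (x i))]⟩ e

/-- A kernel: a symmetric measurable function `[0,1]² → [0,∞)`. -/
def IsKernel (κ : ℝ → ℝ → ℝ) : Prop :=
  Measurable (Function.uncurry κ) ∧ (∀ x y, κ x y = κ y x) ∧ ∀ x y, 0 ≤ κ x y

/-- A kernel taking values in `[0,C]`. -/
def IsKernelBdd (κ : ℝ → ℝ → ℝ) (C : ℝ) : Prop :=
  Measurable (Function.uncurry κ) ∧ (∀ x y, κ x y = κ y x) ∧ ∀ x y, κ x y ∈ Icc 0 C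

/-- A standard kernel: a symmetric measurable function `[0,1]² → [0,1]`. -/
def IsStdKernel (κ : ℝ → ℝ → ℝ) : Prop := IsKernelBdd κ 1

/-- A doubly stochastic measure: a Borel measure on `[0,1]²` both of whose marginals
are Lebesgue measure on `[0,1]`. -/
def IsDoublyStochastic (μ : Measure (ℝ × ℝ)) : Prop :=
  μ.map Prod.fst = volume.restrict (Icc 0 1) ∧ μ.map Prod.snd = volume.restrict (Icc 0 1)

/-- The quantity `d_μ(κ₁,κ₂)`. -/
def dMu (μ : Measure (ℝ × ℝ)) (κ₁ κ₂ : ℝ → ℝ → ℝ) : ℝ :=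
  sSup {r | ∃ S T : Set (ℝ × ℝ), MeasurableSet S ∧ MeasurableSet T ∧
    S ⊆ Icc 0 1 ×ˢ Icc 0 1 ∧ T ⊆ Icc 0 1 ×ˢ Icc 0 1 ∧
    r = |∫ w in S ×ˢ T, (κ₁ w.1.1 w.2.1 - κ₂ w.1.2 w.2.2) ∂(μ.prod μ)|}

/-- Equivalence of kernels via a coupling. -/
def KernelEquiv (κ₁ κ₂ : ℝ → ℝ → ℝ) : Prop :=
  ∃ μ : Measure (ℝ × ℝ), IsDoublyStochastic μ ∧
    ∀ᵐ w ∂(μ.prod μ), κ₁ w.1.1 w.2.1 = κ₂ w.1.2 w.2.2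

/-- `e_G(A,B)`: the number of ordered pairs `(i,j) ∈ A × B` with `ij ∈ E(G)`. -/
def ePairs {n : ℕ} (G : SimpleGraph (Fin n)) (A B : Finset (Fin n)) : ℕ :=
  ((A ×ˢ B).filter fun q => G.Adj q.1 q.2).card

/-- The normalized density `d_p(A,B)`. -/
def dDens {n : ℕ} (p : ℝ) (G : SimpleGraph (Fin n)) (A B : Finset (Fin n)) : ℝ :=
  ePairs G A B / (p * A.card * B.card)

/-- A sequence of graphs has density bounded by `C`. -/
def DensityBoundedBy (p : ℕ → ℝ) (G : ∀ n, SimpleGraph (Fin n)) (C : ℝ) : Prop :=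
  ∀ ε > (0:ℝ), ∀ δ > (0:ℝ), ∀ᶠ n in atTop, ∀ A B : Finset (Fin n),
    ε * n ≤ A.card → ε * n ≤ B.card → dDens (p n) (G n) A B ≤ C + δ

/-- The parts of a partition of `Fin n` indexed by `Fin k`, given as a colouring. -/
def fiber {n k : ℕ} (c : Fin n → Fin k) (a : Fin k) : Finset (Fin n) :=
  Finset.univ.filter fun v => c v = a

/-- The finite-type kernel `G/Π` associated to a partition of the vertex set of `G`. -/
def partKernel {n k : ℕ} (p : ℝ) (G : SimpleGraph (Fin n)) (c : Fin n → Fin k) :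
    ℝ → ℝ → ℝ := fun x y =>
  if h : x ∈ Ioc (0:ℝ) 1 ∧ y ∈ Ioc (0:ℝ) 1 ∧ idx n x < n ∧ idx n y < n then
    dDens p G (fiber c (c ⟨idx n x, h.2.2.1⟩)) (fiber c (c ⟨idx n y, h.2.2.2⟩))
  else 0

/-- A partition is weakly `(ε,p)`-regular for `G`. -/
def WeaklyRegular {n k : ℕ} (p ε : ℝ) (G : SimpleGraph (Fin n)) (c : Fin n → Fin k) : Prop :=
  cutNorm (fun x y => graphKernel p G x y - partKernel p G c x y) ≤ ε

/-- `(A,B)` is an `(ε,p)`-regular pair for `G`. -/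
def RegPair {n : ℕ} (p ε : ℝ) (G : SimpleGraph (Fin n)) (A B : Finset (Fin n)) : Prop :=
  ∀ A' ⊆ A, ∀ B' ⊆ B, ε * A.card ≤ A'.card → ε * B.card ≤ B'.card →
    |dDens p G A' B' - dDens p G A B| ≤ ε

/-- An `(ε,p)`-regular partition of `G` into `k` parts. -/
def RegPartition {n k : ℕ} (p ε : ℝ) (G : SimpleGraph (Fin n)) (c : Fin n → Fin k) : Prop :=
  (∀ a : Fin k, (fiber c a).card = n / k ∨ (fiber c a).card = n / k + 1) ∧
  ((Finset.univ.filter (fun q : Fin k × Fin k =>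
      q.1 < q.2 ∧ ¬ RegPair p ε G (fiber c q.1) (fiber c q.2))).card : ℝ)
    ≤ ε * ((k : ℝ) * ((k : ℝ) - 1) / 2)

/-- The number of walks `v₀v₁⋯v_ℓ` in `G` with `v_i ∈ X_i` for each `i`. -/
def walkCount {n ℓ : ℕ} (G : SimpleGraph (Fin n)) (X : Fin (ℓ+1) → Finset (Fin n)) : ℕ :=
  Nat.card {v : Fin (ℓ+1) → Fin n //
    (∀ i, v i ∈ X i) ∧ ∀ i : Fin ℓ, G.Adj (v i.castSucc) (v i.succ)}

/-- `κ(X₀,X₁,…,X_ℓ)`: the kernel analogue of the walk count. -/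
def kernelWalk {ℓ : ℕ} (κ : ℝ → ℝ → ℝ) (X : Fin (ℓ+1) → Set ℝ) : ℝ :=
  ∫ x in Set.univ.pi X, ∏ i : Fin ℓ, κ (x i.castSucc) (x i.succ)

/-- `p_t(u,v)`: the number of paths of length `t` in `G` from `u` to `v`. -/
def pathCount {n : ℕ} (G : SimpleGraph (Fin n)) (t : ℕ) (u v : Fin n) : ℕ :=
  Nat.card {w : Fin (t+1) → Fin n // w 0 = u ∧ w (Fin.last t) = v ∧
    Function.Injective w ∧ ∀ i : Fin t, G.Adj (w i.castSucc) (w i.succ)}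

/-- The `i`-th vertex on the `r`-th subdivided edge (from `u r` to `v r`, `ℓ` steps). -/
def pv (ℓ : ℕ) {k m : ℕ} (u v : Fin m → Fin k) (r : Fin m) (i : ℕ) :
    Fin k ⊕ (Fin m × Fin (ℓ - 1)) :=
  if h0 : i = 0 then Sum.inl (u r)
  else if h : i < ℓ then Sum.inr (r, ⟨i - 1, by omega⟩)
  else Sum.inl (v r)

/-- The `(ℓ−1)`-fold subdivision of the loopless multigraph with `k` vertices and
edges `u r — v r` for `r < m`. -/
def multiSubdiv (ℓ : ℕ) {k m : ℕ} (u v : Fin m → Fin k) :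
    SimpleGraph (Fin k ⊕ (Fin m × Fin (ℓ - 1))) :=
  SimpleGraph.fromRel fun a b =>
    ∃ r : Fin m, ∃ i : ℕ, i < ℓ ∧ a = pv ℓ u v r i ∧ b = pv ℓ u v r (i + 1)

/-- Membership in the family `F_ℓ` of `(ℓ−1)`-fold subdivisions of finite loopless
multigraphs. -/
def InFamilyF (ℓ : ℕ) {N : ℕ} (F : SimpleGraph (Fin N)) : Prop :=
  ∃ (k m : ℕ) (u v : Fin m → Fin k), 1 ≤ k ∧ (∀ r, u r ≠ v r) ∧
    Nonempty (F ≃g multiSubdiv ℓ u v)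

/-- The edges of a simple graph on `Fin k`, as ordered pairs `(i,j)` with `i < j`. -/
abbrev edgeIdx {k : ℕ} (F : SimpleGraph (Fin k)) : Type :=
  {q : Fin k × Fin k // q.1 < q.2 ∧ F.Adj q.1 q.2}

/-- The `i`-th vertex on the subdivision of the edge `e` (`t` steps). -/
def spv (t : ℕ) {k : ℕ} {F : SimpleGraph (Fin k)} (e : edgeIdx F) (i : ℕ) :
    Fin k ⊕ (edgeIdx F × Fin (t - 1)) :=
  if h0 : i = 0 then Sum.inl e.1.1
  else if h : i < t then Sum.inr (e, ⟨i - 1, by omega⟩)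
  else Sum.inl e.1.2

/-- The `t`-subdivision `Sub_t(F)` of a simple graph `F`: each edge is replaced by a
path of length `t` through `t−1` new internal vertices. -/
def subdiv (t : ℕ) {k : ℕ} (F : SimpleGraph (Fin k)) :
    SimpleGraph (Fin k ⊕ (edgeIdx F × Fin (t - 1))) :=
  SimpleGraph.fromRel fun a b =>
    ∃ e : edgeIdx F, ∃ i : ℕ, i < t ∧ a = spv t e i ∧ b = spv t e (i + 1)

/-- The `t`-th power kernel `κ^t`. -/
def kpow (κ : ℝ → ℝ → ℝ) : ℕ → ℝ → ℝ → ℝ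
  | 0 => fun _ _ => 0
  | 1 => κ
  | (n + 2) => fun x y => ∫ z in Icc (0:ℝ) 1, kpow κ (n + 1) x z * κ z y

/-- `φ : Fin ℓ → Fin n` is a homomorphism from `F` to `G`. -/
def IsHom {α β : Type*} (F : SimpleGraph α) (G : SimpleGraph β) (φ : α → β) : Prop :=
  ∀ i j, F.Adj i j → G.Adj (φ i) (φ j)

/-- `F` is flat over its induced subgraph `F'` on the first `ℓ` vertices, for the
sequence `(G_n)` with normalizing function `p`. -/
def FlatOver (p : ℕ → ℝ) (G : ∀ n, SimpleGraph (Fin n)) {k ℓ : ℕ} (h : ℓ ≤ k)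
    (F : SimpleGraph (Fin k)) : Prop :=
  ∀ ε > (0:ℝ), ∀ᶠ n in atTop,
    ((Finset.univ.filter (fun φ : Fin ℓ → Fin n =>
        IsHom (F.comap (Fin.castLE h)) (G n) φ ∧
        ε * ((n:ℝ) ^ (k - ℓ) * p n ^ (edgeCount F - edgeCount (F.comap (Fin.castLE h)))) <
          |((Finset.univ.filter (fun ψ : Fin k → Fin n =>
              IsHom F (G n) ψ ∧ ψ ∘ Fin.castLE h = φ)).card : ℝ) -
            (n:ℝ) ^ (k - ℓ) * p n ^ (edgeCount F - edgeCount (F.comap (Fin.castLE h)))|)).card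
      : ℝ)
      ≤ ε * ((Finset.univ.filter (fun φ : Fin ℓ → Fin n =>
          IsHom (F.comap (Fin.castLE h)) (G n) φ)).card : ℝ)

/-- The set of density matrices of balanced partitions of `V(G)` into `k` nonempty
parts. -/
def MsetG (k : ℕ) {n : ℕ} (p : ℝ) (G : SimpleGraph (Fin n)) : Set (Fin k → Fin k → ℝ) :=
  {M | ∃ c : Fin n → Fin k, Function.Surjective c ∧
    (∀ a b, (fiber c a).card ≤ (fiber c b).card + 1) ∧
    M = fun a b => dDens p G (fiber c a) (fiber c b)}

/-- The closed set of density matrices of partitions of `[0,1]` into `k` parts of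
measure `1/k`, for a kernel `κ`. -/
def MsetK (k : ℕ) (κ : ℝ → ℝ → ℝ) : Set (Fin k → Fin k → ℝ) :=
  closure {M | ∃ Q : Fin k → Set ℝ, (∀ a, MeasurableSet (Q a)) ∧
    (Pairwise fun a b => Disjoint (Q a) (Q b)) ∧ (⋃ a, Q a) = Icc 0 1 ∧
    (∀ a, volume (Q a) = 1 / (k : ℝ≥0∞)) ∧
    M = fun a b => (k : ℝ)^2 * ∫ q in (Q a) ×ˢ (Q b), κ q.1 q.2}

end

section WeakRegularity

/-- Truncation of a real number to the interval `[0, C]`. -/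
noncomputable def clip (C v : ℝ) : ℝ := max 0 (min v C)

/-- An antiderivative of `clip C`, vanishing at `0`. -/
noncomputable def clipPot (C v : ℝ) : ℝ := (max v 0 ^ 2 - max (v - C) 0 ^ 2) / 2

lemma clip_mem {C : ℝ} (hC : 0 ≤ C) (v : ℝ) : clip C v ∈ Icc 0 C :=
  ⟨le_max_left _ _, max_le hC (min_le_right _ _)⟩

lemma clipPot_add_le {C : ℝ} (hC : 0 ≤ C) (v h : ℝ) :
    clipPot C (v + h) ≤ clipPot C v + h * clip C v + h ^ 2 / 2 := by
  unfold clipPot clip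
  rcases max_cases (v + h) 0 with ⟨e1, h1⟩ | ⟨e1, h1⟩ <;>
  rcases max_cases (v + h - C) 0 with ⟨e2, h2⟩ | ⟨e2, h2⟩ <;>
  rcases max_cases v 0 with ⟨e3, h3⟩ | ⟨e3, h3⟩ <;>
  rcases max_cases (v - C) 0 with ⟨e4, h4⟩ | ⟨e4, h4⟩ <;>
  rcases min_cases v C with ⟨e5, h5⟩ | ⟨e5, h5⟩ <;>
  simp only [e1, e2, e3, e4, e5] <;>
  first
  | (rw [max_eq_right (by linarith)]; nlinarith)
  | (rw [max_eq_left (by linarith)]; nlinarith)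

lemma le_clipPot {C : ℝ} (hC : 0 ≤ C) (v : ℝ) :
    C * max v 0 - C ^ 2 / 2 ≤ clipPot C v := by
  unfold clipPot
  rcases max_cases v 0 with ⟨e3, h3⟩ | ⟨e3, h3⟩ <;>
  rcases max_cases (v - C) 0 with ⟨e4, h4⟩ | ⟨e4, h4⟩ <;>
  simp only [e3, e4] <;> nlinarith [sq_nonneg (v - C)]

/-- If the density of `w` on all rectangles is at most `C` up to an additive error, the same holds
for its pairing with functions that are constant on the cells of a fixed partition. -/
lemma sum_mul_comp_le {V K : Type*} [Fintype V] [Fintype K] {w : V → V → ℝ} {C η b N : ℝ}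
    (hw : ∀ A B : Finset V, ∑ i ∈ A, ∑ j ∈ B, w i j ≤ C * A.card * B.card + η * N)
    (hηN : 0 ≤ η * N) (c : V → K) (m : K → K → ℝ) (hm0 : ∀ a b', 0 ≤ m a b')
    (hmb : ∀ a b', m a b' ≤ b) :
    ∑ i, ∑ j, w i j * m (c i) (c j) ≤
      ∑ i, ∑ j, C * m (c i) (c j) + (Fintype.card K : ℝ) ^ 2 * b * (η * N) := by
  have key : ∀ u : V → V → ℝ, ∑ i, ∑ j, u i j * m (c i) (c j) =
      ∑ a, ∑ b', m a b' * ∑ i ∈ Finset.univ.filter (fun i => c i = a),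
        ∑ j ∈ Finset.univ.filter (fun j => c j = b'), u i j := by
    intro u
    rw [← Finset.sum_fiberwise Finset.univ c (fun i => ∑ j, u i j * m (c i) (c j))]
    refine Finset.sum_congr rfl fun a _ => ?_
    simp_rw [Finset.mul_sum]
    conv_rhs => rw [Finset.sum_comm]
    refine Finset.sum_congr rfl fun i hi => ?_
    rw [← Finset.sum_fiberwise Finset.univ c (fun j => u i j * m (c i) (c j))]
    refine Finset.sum_congr rfl fun b' _ => ?_
    refine Finset.sum_congr rfl fun j hj => ?_
    simp only [Finset.mem_filter, Finset.mem_univ, true_and] at hi hj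
    rw [hi, hj, mul_comm]
  rw [key, key (fun _ _ => C)]
  have : (Fintype.card K : ℝ) ^ 2 * b * (η * N) = ∑ _a : K, ∑ _b' : K, b * (η * N) := by
    simp; ring
  rw [this, ← Finset.sum_add_distrib]
  refine Finset.sum_le_sum fun a _ => ?_
  rw [← Finset.sum_add_distrib]
  refine Finset.sum_le_sum fun b' _ => ?_
  have h1 := mul_le_mul_of_nonneg_left (hw (Finset.univ.filter (fun i => c i = a))
    (Finset.univ.filter (fun j => c j = b'))) (hm0 a b')
  have h2 := mul_le_mul_of_nonneg_right (hmb a b') hηN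
  simp only [Finset.sum_const, nsmul_eq_mul]
  nlinarith

/-- A signed sum of indicator matrices of the rectangles `A t × B t`, scaled by `ε`. -/
noncomputable def cutSum {V : Type*} (ε : ℝ) (T : ℕ) (s : ℕ → Bool) (A B : ℕ → Finset V)
    (i j : V) : ℝ :=
  ε * ∑ t ∈ Finset.range T, (if s t then 1 else -1) *
    ((if i ∈ A t then 1 else 0) * (if j ∈ B t then 1 else 0))

/-- The membership pattern of `i` in the first `T` sets of two sequences of sets. -/
noncomputable def pattern {V : Type*} (T : ℕ) (A B : ℕ → Finset V) (i : V) : Fin T → Bool × Bool :=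
  fun t => (decide (i ∈ A t), decide (i ∈ B t))

/-- The value of `cutSum` in terms of the membership patterns of the two indices. -/
noncomputable def patternSum (ε : ℝ) {T : ℕ} (s : Fin T → Bool) (a b : Fin T → Bool × Bool) : ℝ :=
  ε * ∑ t, (if s t then 1 else -1) *
    ((if (a t).1 then 1 else 0) * (if (b t).2 then 1 else 0))

lemma cutSum_eq_patternSum {V : Type*} (ε : ℝ) (T : ℕ) (s : ℕ → Bool) (A B : ℕ → Finset V)
    (i j : V) : cutSum ε T s A B i j = patternSum (T := T) ε (fun t => s t)
      (pattern T A B i) (pattern T A B j) := by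
  simp [cutSum, patternSum, pattern, Finset.sum_range]

lemma patternSum_le {ε : ℝ} (hε : 0 ≤ ε) {T : ℕ} (s : Fin T → Bool)
    (a b : Fin T → Bool × Bool) : patternSum ε s a b ≤ ε * T := by
  unfold patternSum
  refine mul_le_mul_of_nonneg_left ?_ hε
  calc _ ≤ ∑ _t : Fin T, (1 : ℝ) := Finset.sum_le_sum fun t _ => by split_ifs <;> norm_num
    _ = T := by simp

/-- Energy decrement: as long as the truncation of the current matrix is not close to `w` in
cut norm, a further rectangle can be added so that the energy drops by a definite amount. -/
lemma exists_energy_decrement {V : Type*} [Fintype V] {w : V → V → ℝ} {C ε : ℝ} (hC : 0 ≤ C)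
    (hε : 0 < ε) (T : ℕ)
    (hbad : ∀ s A B, ∃ S T' : Finset V, ε * (Fintype.card V : ℝ) ^ 2 <
      |∑ i ∈ S, ∑ j ∈ T', (w i j - clip C (cutSum ε T s A B i j))|) (t : ℕ) (ht : t ≤ T) :
    ∃ s A B, (∀ r, t ≤ r → A r = ∅) ∧
      ∑ i, ∑ j, (clipPot C (cutSum ε T s A B i j) - w i j * cutSum ε T s A B i j) ≤
        - (t * (ε ^ 2 * (Fintype.card V : ℝ) ^ 2 / 2)) := by
  induction t with
  | zero =>
    refine ⟨fun _ => true, fun _ => ∅, fun _ => ∅, fun _ _ => rfl, ?_⟩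
    simp [cutSum, clipPot, hC]
  | succ t ih =>
    obtain ⟨s, A, B, hA, hQ⟩ := ih (by omega)
    obtain ⟨S, T', hST⟩ := hbad s A B
    set σ : Bool := decide (0 ≤ ∑ i ∈ S, ∑ j ∈ T', (w i j - clip C (cutSum ε T s A B i j)))
      with hσ
    refine ⟨Function.update s t σ, Function.update A t S, Function.update B t T',
      fun r hr => ?_, ?_⟩
    · rw [Function.update_of_ne (by omega)]
      exact hA r (by omega)
    · set h : V → V → ℝ := fun i j => ε * ((if σ then 1 else -1) *
        ((if i ∈ S then 1 else 0) * (if j ∈ T' then 1 else 0))) with hh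
      have hstep : ∀ i j, cutSum ε T (Function.update s t σ) (Function.update A t S)
          (Function.update B t T') i j = cutSum ε T s A B i j + h i j := by
        intro i j
        simp only [cutSum, hh]
        rw [← mul_add]
        congr 1
        have htm : t ∈ Finset.range T := Finset.mem_range.2 (by omega)
        rw [← Finset.add_sum_erase _ _ htm, ← Finset.add_sum_erase _ _ htm]
        simp only [Function.update_self, hA t le_rfl, Finset.notMem_empty, if_false, zero_mul,
          mul_zero, zero_add]
        rw [add_comm]
        congr 1
        refine Finset.sum_congr rfl fun r hr => ?_
        have := Finset.ne_of_mem_erase hr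
        simp [Function.update_of_ne this]
      have hhsq : ∀ i j, h i j ^ 2 ≤ ε ^ 2 := by
        intro i j
        simp only [hh]
        have := sq_nonneg ε
        split_ifs <;> simp [this]
      have hgain : ε ^ 2 * (Fintype.card V : ℝ) ^ 2 ≤
          ∑ i, ∑ j, h i j * (w i j - clip C (cutSum ε T s A B i j)) := by
        have e1 : ∑ i, ∑ j, h i j * (w i j - clip C (cutSum ε T s A B i j)) =
            ε * ((if σ then 1 else -1) *
              ∑ i ∈ S, ∑ j ∈ T', (w i j - clip C (cutSum ε T s A B i j))) := by
          simp only [hh, Finset.mul_sum]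
          rw [← Finset.sum_filter_add_sum_filter_not Finset.univ (· ∈ S)]
          rw [Finset.sum_eq_zero (s := Finset.univ.filter (· ∉ S))]
          · rw [add_zero, Finset.filter_mem_eq_inter, Finset.univ_inter]
            refine Finset.sum_congr rfl fun i hi => ?_
            rw [← Finset.sum_filter_add_sum_filter_not Finset.univ (· ∈ T')]
            rw [Finset.sum_eq_zero (s := Finset.univ.filter (· ∉ T'))]
            · rw [add_zero, Finset.filter_mem_eq_inter, Finset.univ_inter]
              refine Finset.sum_congr rfl fun j hj => ?_
              simp only [hi, hj, if_true, mul_one]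
              ring
            · intro j hj
              simp at hj
              simp [hj]
          · intro i hi
            simp at hi
            simp [hi]
        have e2 : (if σ then (1 : ℝ) else -1) *
              ∑ i ∈ S, ∑ j ∈ T', (w i j - clip C (cutSum ε T s A B i j)) =
            |∑ i ∈ S, ∑ j ∈ T', (w i j - clip C (cutSum ε T s A B i j))| := by
          by_cases hs : 0 ≤ ∑ i ∈ S, ∑ j ∈ T', (w i j - clip C (cutSum ε T s A B i j))
          · simp only [hσ, hs, decide_true, if_true, one_mul, abs_of_nonneg]
          · simp only [hσ, hs, decide_false, Bool.false_eq_true, if_false, neg_one_mul]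
            rw [abs_of_neg (not_le.1 hs)]
        rw [e1, e2]
        nlinarith [mul_le_mul_of_nonneg_left hST.le hε.le]
      calc _ ≤ ∑ i, ∑ j, ((clipPot C (cutSum ε T s A B i j) - w i j * cutSum ε T s A B i j)
            - h i j * (w i j - clip C (cutSum ε T s A B i j)) + ε ^ 2 / 2) := by
            refine Finset.sum_le_sum fun i _ => Finset.sum_le_sum fun j _ => ?_
            rw [hstep]
            have := clipPot_add_le hC (cutSum ε T s A B i j) (h i j)
            have := hhsq i j
            linarith
        _ ≤ _ := by
            simp only [Finset.sum_add_distrib, Finset.sum_sub_distrib] at hQ hgain ⊢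
            simp only [Finset.sum_const, Finset.card_univ, nsmul_eq_mul]
            push_cast
            nlinarith

/-- Sparse weak regularity lemma: a nonnegative matrix whose density on all rectangles is at most
`C` up to a small additive error is close in cut norm to a matrix with values in `[0, C]` that is
constant on the cells of a partition into boundedly many parts; the values of the latter come
from a finite set. -/
lemma exists_weak_regularity {C ε : ℝ} (hC : 0 ≤ C) (hε : 0 < ε) :
    ∃ K : ℕ, 0 < K ∧ ∃ F : Set (ℕ → ℕ → ℝ), F.Finite ∧ (∀ M ∈ F, ∀ a b, M a b ∈ Icc 0 C) ∧
      ∃ η > 0, ∀ (n : ℕ), 0 < n → ∀ w : Fin n → Fin n → ℝ, (∀ i j, 0 ≤ w i j) →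
        (∀ A B : Finset (Fin n), ∑ i ∈ A, ∑ j ∈ B, w i j ≤ C * A.card * B.card + η * (n : ℝ) ^ 2) →
        ∃ c : Fin n → ℕ, (∀ i, c i < K) ∧ ∃ M ∈ F, ∀ S T : Finset (Fin n),
          |∑ i ∈ S, ∑ j ∈ T, (w i j - M (c i) (c j))| ≤ ε * (n : ℝ) ^ 2 := by
  obtain ⟨T, hT⟩ := exists_nat_gt ((C ^ 2 + 2) / ε ^ 2)
  have hT' : C ^ 2 + 2 < T * ε ^ 2 := by rwa [div_lt_iff₀ (by positivity)] at hT
  let P := Fin T → Bool × Bool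
  let e : P ≃ Fin (Fintype.card P) := Fintype.equivFin P
  have hK : 0 < Fintype.card P := Fintype.card_pos
  let d : ℕ → P := fun a => if h : a < Fintype.card P then e.symm ⟨a, h⟩ else fun _ => default
  have hd : ∀ q : P, d (e q) = q := fun q => by simp [d]
  refine ⟨Fintype.card P, hK,
    range fun (s : Fin T → Bool) a b => clip C (patternSum ε s (d a) (d b)),
    Set.finite_range _, ?_, 1 / ((Fintype.card P : ℝ) ^ 2 * (ε * T) + 1), by positivity, ?_⟩
  · rintro _ ⟨s, rfl⟩ a b
    exact clip_mem hC _
  intro n hn w hw0 hw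
  set η : ℝ := 1 / ((Fintype.card P : ℝ) ^ 2 * (ε * T) + 1) with hη
  have hη0 : 0 < η := by positivity
  by_contra hcon
  push Not at hcon
  have hbad : ∀ s A B, ∃ S T' : Finset (Fin n), ε * (Fintype.card (Fin n) : ℝ) ^ 2 <
      |∑ i ∈ S, ∑ j ∈ T', (w i j - clip C (cutSum ε T s A B i j))| := by
    intro s A B
    obtain ⟨S, T', h⟩ := hcon
      (fun i => e (pattern T A B i)) (fun i => (e _).2) _
      ⟨fun t => s t, rfl⟩
    refine ⟨S, T', ?_⟩
    simpa only [hd, ← cutSum_eq_patternSum, Fintype.card_fin] using h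
  obtain ⟨s, A, B, -, hQ⟩ := exists_energy_decrement hC hε T hbad T le_rfl
  have hlow := sum_mul_comp_le hw (by positivity)
    (pattern T A B)
    (fun a b => max (patternSum ε (fun t : Fin T => s t) a b) 0) (fun _ _ => le_max_right _ _)
    (b := ε * T) (fun a b => max_le (patternSum_le hε.le _ _ _) (by positivity))
  simp only [← cutSum_eq_patternSum] at hlow
  have hpt : ∑ i, ∑ j, (C * max (cutSum ε T s A B i j) 0 - C ^ 2 / 2
      - w i j * max (cutSum ε T s A B i j) 0) ≤
      ∑ i, ∑ j, (clipPot C (cutSum ε T s A B i j) - w i j * cutSum ε T s A B i j) := by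
    refine Finset.sum_le_sum fun i _ => Finset.sum_le_sum fun j _ => ?_
    have h1 := le_clipPot hC (cutSum ε T s A B i j)
    have h2 := mul_le_mul_of_nonneg_left (le_max_left (cutSum ε T s A B i j) 0) (hw0 i j)
    linarith
  have hηle : (Fintype.card P : ℝ) ^ 2 * (ε * T) * η ≤ 1 := by
    rw [hη, mul_one_div, div_le_one (by positivity)]
    linarith
  simp only [Finset.sum_sub_distrib, Finset.sum_const, Finset.card_univ, Fintype.card_fin,
    nsmul_eq_mul] at hpt hQ
  have hn2 : (0 : ℝ) < (n : ℝ) ^ 2 := by positivity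
  have h3 := mul_le_mul_of_nonneg_right hηle hn2.le
  have h4 := mul_lt_mul_of_pos_right hT' hn2
  simp only [P] at h3
  nlinarith

end WeakRegularity

section StepKernels

/-- The `i`-th of the `n` intervals of length `1/n` partitioning `(0,1]`. -/
def cell (n i : ℕ) : Set ℝ := Ioc ((i : ℝ) / n) (((i : ℝ) + 1) / n)

lemma measurableSet_cell (n i : ℕ) : MeasurableSet (cell n i) := measurableSet_Ioc

lemma idx_lt {n : ℕ} (hn : 0 < n) {x : ℝ} (hx : x ∈ Ioc (0 : ℝ) 1) : idx n x < n := by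
  have h1 : ⌈x * n⌉₊ ≤ n := Nat.ceil_le.2 (by nlinarith [hx.2, (Nat.cast_nonneg n : (0 : ℝ) ≤ n)])
  unfold idx
  omega

lemma mem_cell_iff {n : ℕ} (hn : 0 < n) {x : ℝ} (hx : 0 < x) (i : ℕ) :
    x ∈ cell n i ↔ idx n x = i := by
  have hn' : (0 : ℝ) < n := by exact_mod_cast hn
  have h0 : 0 < ⌈x * n⌉₊ := Nat.ceil_pos.2 (by positivity)
  have h1 : idx n x = i ↔ ⌈x * n⌉₊ = i + 1 := by unfold idx; omega
  rw [h1, Nat.ceil_eq_iff (by omega), cell, mem_Ioc, div_lt_iff₀ hn', le_div_iff₀ hn']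
  simp

lemma cell_subset {n i : ℕ} (hi : i < n) : cell n i ⊆ Ioc 0 1 := by
  have hn' : (0 : ℝ) < n := by exact_mod_cast (by omega : 0 < n)
  have hi' : (i : ℝ) + 1 ≤ n := by exact_mod_cast hi
  intro x hx
  exact ⟨lt_of_le_of_lt (by positivity) hx.1, hx.2.trans ((div_le_one hn').2 hi')⟩

lemma volume_real_cell {n : ℕ} (hn : 0 < n) (i : ℕ) : volume.real (cell n i) = 1 / n := by
  have hn' : (0 : ℝ) < n := by exact_mod_cast hn
  rw [cell, Real.volume_real_Ioc_of_le (by gcongr; linarith)]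
  field_simp
  ring

/-- The step function on `[0,1]²` associated to an `n × n` matrix. -/
noncomputable def stepKernel {n : ℕ} (A : Fin n → Fin n → ℝ) : ℝ → ℝ → ℝ := fun x y =>
  if h : x ∈ Ioc (0:ℝ) 1 ∧ y ∈ Ioc (0:ℝ) 1 ∧ idx n x < n ∧ idx n y < n then
    A ⟨idx n x, h.2.2.1⟩ ⟨idx n y, h.2.2.2⟩
  else 0

/-- The normalized adjacency matrix of a graph. -/
noncomputable def adjWeight {n : ℕ} (p : ℝ) (G : SimpleGraph (Fin n)) (i j : Fin n) : ℝ :=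
  if G.Adj i j then 1 / p else 0

lemma graphKernel_eq_stepKernel {n : ℕ} (p : ℝ) (G : SimpleGraph (Fin n)) :
    graphKernel p G = stepKernel (adjWeight p G) := rfl

lemma stepKernel_eq_sum {n : ℕ} (hn : 0 < n) (A : Fin n → Fin n → ℝ) (x y : ℝ) :
    stepKernel A x y =
      ∑ i : Fin n, ∑ j : Fin n, (cell n i ×ˢ cell n j).indicator (fun _ => A i j) (x, y) := by
  by_cases hx : x ∈ Ioc (0 : ℝ) 1
  · by_cases hy : y ∈ Ioc (0 : ℝ) 1
    · have hxn := idx_lt hn hx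
      have hyn := idx_lt hn hy
      rw [stepKernel, dif_pos ⟨hx, hy, hxn, hyn⟩, Finset.sum_eq_single ⟨idx n x, hxn⟩,
        Finset.sum_eq_single ⟨idx n y, hyn⟩]
      · rw [indicator_of_mem]
        exact ⟨(mem_cell_iff hn hx.1 _).2 rfl, (mem_cell_iff hn hy.1 _).2 rfl⟩
      · intro j _ hj
        refine indicator_of_notMem (fun h => hj ?_) _
        exact Fin.ext ((mem_cell_iff hn hy.1 _).1 h.2).symm
      · simp
      · intro i _ hi
        refine Finset.sum_eq_zero fun j _ => indicator_of_notMem (fun h => hi ?_) _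
        exact Fin.ext ((mem_cell_iff hn hx.1 _).1 h.1).symm
      · simp
    · rw [stepKernel, dif_neg (by tauto)]
      refine (Finset.sum_eq_zero fun i _ => Finset.sum_eq_zero fun j _ => ?_).symm
      exact indicator_of_notMem (fun h => hy (cell_subset j.2 h.2)) _
  · rw [stepKernel, dif_neg (by tauto)]
    refine (Finset.sum_eq_zero fun i _ => Finset.sum_eq_zero fun j _ => ?_).symm
    exact indicator_of_notMem (fun h => hx (cell_subset i.2 h.1)) _

lemma measurable_stepKernel {n : ℕ} (hn : 0 < n) (A : Fin n → Fin n → ℝ) :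
    Measurable (fun q : ℝ × ℝ => stepKernel A q.1 q.2) := by
  simp only [stepKernel_eq_sum hn]
  exact Finset.measurable_sum _ fun i _ => Finset.measurable_sum _ fun j _ =>
    measurable_const.indicator ((measurableSet_cell n i).prod (measurableSet_cell n j))

lemma volume_cell_ne_top (n i : ℕ) : volume (cell n i) ≠ ⊤ := measure_Ioc_lt_top.ne

lemma integrable_cell_indicator (n i j : ℕ) (a : ℝ) :
    Integrable ((cell n i ×ˢ cell n j).indicator (fun _ : ℝ × ℝ => a)) := by
  refine (integrable_indicator_iff ((measurableSet_cell n i).prod (measurableSet_cell n j))).2 ?_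
  refine integrableOn_const ?_
  rw [Measure.volume_eq_prod, Measure.prod_prod]
  exact ENNReal.mul_ne_top (volume_cell_ne_top n i) (volume_cell_ne_top n j)

lemma integrable_stepKernel {n : ℕ} (hn : 0 < n) (A : Fin n → Fin n → ℝ) :
    Integrable (fun q : ℝ × ℝ => stepKernel A q.1 q.2) := by
  simp only [stepKernel_eq_sum hn]
  exact integrable_finsetSum _ fun i _ => integrable_finsetSum _ fun j _ =>
    integrable_cell_indicator n i j _

lemma setIntegral_stepKernel {n : ℕ} (hn : 0 < n) (A : Fin n → Fin n → ℝ) {S T : Set ℝ} :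
    ∫ q in S ×ˢ T, stepKernel A q.1 q.2 =
      ∑ i : Fin n, ∑ j : Fin n,
        A i j * (volume.real (cell n i ∩ S) * volume.real (cell n j ∩ T)) := by
  simp only [stepKernel_eq_sum hn, Prod.mk.eta]
  rw [integral_finsetSum Finset.univ fun (i : Fin n) _ => integrable_finsetSum Finset.univ
    fun (j : Fin n) _ => (integrable_cell_indicator n i j (A i j)).restrict]
  refine Finset.sum_congr rfl fun i _ => ?_
  rw [integral_finsetSum Finset.univ fun (j : Fin n) _ =>
    (integrable_cell_indicator n i j (A i j)).restrict]
  refine Finset.sum_congr rfl fun j _ => ?_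
  rw [integral_indicator ((measurableSet_cell n i).prod (measurableSet_cell n j)),
    setIntegral_const, measureReal_restrict_apply
      ((measurableSet_cell n i).prod (measurableSet_cell n j)), prod_inter_prod,
    Measure.volume_eq_prod, measureReal_prod_prod, smul_eq_mul, mul_comm]

/-- A bilinear form on the cube is bounded by its largest value at a vertex. -/
lemma exists_finset_sum_le {V : Type*} [Fintype V] (A : V → V → ℝ) (f g : V → ℝ)
    (hf : ∀ i, f i ∈ Icc (0 : ℝ) 1) (hg : ∀ i, g i ∈ Icc (0 : ℝ) 1) :
    ∃ S T : Finset V, ∑ i, ∑ j, A i j * (f i * g j) ≤ ∑ i ∈ S, ∑ j ∈ T, A i j := by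
  have key : ∀ a f : V → ℝ, (∀ i, f i ∈ Icc (0 : ℝ) 1) →
      ∑ i, f i * a i ≤ ∑ i ∈ Finset.univ.filter (fun i => 0 ≤ a i), a i := by
    intro a f hf
    rw [Finset.sum_filter]
    refine Finset.sum_le_sum fun i _ => ?_
    have h0 := (hf i).1
    have h1 := (hf i).2
    split_ifs with h <;> nlinarith
  set S := Finset.univ.filter (fun i => 0 ≤ ∑ j, A i j * g j)
  refine ⟨S, Finset.univ.filter (fun j => 0 ≤ ∑ i ∈ S, A i j), ?_⟩
  calc ∑ i, ∑ j, A i j * (f i * g j) = ∑ i, f i * ∑ j, A i j * g j := by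
        simp only [Finset.mul_sum]
        refine Finset.sum_congr rfl fun i _ => Finset.sum_congr rfl fun j _ => by ring
    _ ≤ ∑ i ∈ S, ∑ j, A i j * g j := key _ _ hf
    _ = ∑ j, g j * ∑ i ∈ S, A i j := by
        rw [Finset.sum_comm]
        simp only [Finset.mul_sum]
        refine Finset.sum_congr rfl fun i _ => Finset.sum_congr rfl fun j _ => by ring
    _ ≤ ∑ j ∈ Finset.univ.filter (fun j => 0 ≤ ∑ i ∈ S, A i j), ∑ i ∈ S, A i j := key _ _ hg
    _ = _ := Finset.sum_comm

/-- The integrals of `W` and `W'` over measurable rectangles in `[0,1]²` differ by at most `ε`. -/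
def CutClose (W W' : ℝ → ℝ → ℝ) (ε : ℝ) : Prop :=
  ∀ S T : Set ℝ, MeasurableSet S → MeasurableSet T → S ⊆ Icc 0 1 → T ⊆ Icc 0 1 →
    |(∫ q in S ×ˢ T, W q.1 q.2) - ∫ q in S ×ˢ T, W' q.1 q.2| ≤ ε

lemma CutClose.symm {W W' : ℝ → ℝ → ℝ} {ε : ℝ} (h : CutClose W W' ε) : CutClose W' W ε :=
  fun S T hS hT hS1 hT1 => by rw [abs_sub_comm]; exact h S T hS hT hS1 hT1

lemma CutClose.trans {W W' W'' : ℝ → ℝ → ℝ} {ε ε' : ℝ} (h : CutClose W W' ε)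
    (h' : CutClose W' W'' ε') : CutClose W W'' (ε + ε') :=
  fun S T hS hT hS1 hT1 => (abs_sub_le _ _ _).trans
    (add_le_add (h S T hS hT hS1 hT1) (h' S T hS hT hS1 hT1))

lemma CutClose.mono {W W' : ℝ → ℝ → ℝ} {ε ε' : ℝ} (h : CutClose W W' ε) (hε : ε ≤ ε') :
    CutClose W W' ε' :=
  fun S T hS hT hS1 hT1 => (h S T hS hT hS1 hT1).trans hε

lemma cutClose_stepKernel {n : ℕ} (hn : 0 < n) {A B : Fin n → Fin n → ℝ} {ε : ℝ}
    (h : ∀ S T : Finset (Fin n), |∑ i ∈ S, ∑ j ∈ T, (A i j - B i j)| ≤ ε * (n : ℝ) ^ 2) :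
    CutClose (stepKernel A) (stepKernel B) ε := by
  intro S T hS hT _ _
  have hn' : (0 : ℝ) < n := by exact_mod_cast hn
  have hmem : ∀ (S : Set ℝ) (i : Fin n), n * volume.real (cell n i ∩ S) ∈ Icc (0 : ℝ) 1 := by
    intro S i
    refine ⟨by positivity, ?_⟩
    have := measureReal_mono (μ := volume) (inter_subset_left : cell n i ∩ S ⊆ cell n i)
      (volume_cell_ne_top n i)
    rw [volume_real_cell hn] at this
    calc n * volume.real (cell n i ∩ S) ≤ n * (1 / n) := by gcongr
      _ = 1 := by field_simp
  have one_sided : ∀ A B : Fin n → Fin n → ℝ,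
      (∀ S T : Finset (Fin n), ∑ i ∈ S, ∑ j ∈ T, (A i j - B i j) ≤ ε * (n : ℝ) ^ 2) →
      (∫ q in S ×ˢ T, stepKernel A q.1 q.2) - ∫ q in S ×ˢ T, stepKernel B q.1 q.2 ≤ ε := by
    intro A B h
    rw [setIntegral_stepKernel hn, setIntegral_stepKernel hn]
    obtain ⟨S', T', h'⟩ := exists_finset_sum_le (fun i j => A i j - B i j) _ _ (hmem S) (hmem T)
    have h2 := h'.trans (h S' T')
    have e : ∑ i : Fin n, ∑ j : Fin n, (A i j - B i j) * (n * volume.real (cell n i ∩ S) *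
          (n * volume.real (cell n j ∩ T))) = (n : ℝ) ^ 2 * (∑ i : Fin n, ∑ j : Fin n,
          A i j * (volume.real (cell n i ∩ S) * volume.real (cell n j ∩ T)) -
          ∑ i : Fin n, ∑ j : Fin n,
          B i j * (volume.real (cell n i ∩ S) * volume.real (cell n j ∩ T))) := by
      simp only [← Finset.sum_sub_distrib, Finset.mul_sum]
      refine Finset.sum_congr rfl fun i _ => Finset.sum_congr rfl fun j _ => by ring
    rw [e, mul_comm ε] at h2
    exact le_of_mul_le_mul_left h2 (by positivity)
  rw [abs_le]
  constructor
  · have := one_sided B A fun S T => by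
      have := (abs_le.1 (h S T)).1
      have e : ∑ i ∈ S, ∑ j ∈ T, (B i j - A i j) = - ∑ i ∈ S, ∑ j ∈ T, (A i j - B i j) := by
        simp only [← Finset.sum_neg_distrib, neg_sub]
      linarith
    linarith
  · exact one_sided A B fun S T => (abs_le.1 (h S T)).2

lemma cutNorm_nonneg (W : ℝ → ℝ → ℝ) : 0 ≤ cutNorm W :=
  Real.sSup_nonneg (by rintro _ ⟨S, T, -, -, -, -, rfl⟩; exact abs_nonneg _)

lemma CutClose.cutNorm_le {W W' : ℝ → ℝ → ℝ} {ε : ℝ} (h : CutClose W W' ε)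
    (hW : IntegrableOn (fun q : ℝ × ℝ => W q.1 q.2) (Icc 0 1 ×ˢ Icc 0 1))
    (hW' : IntegrableOn (fun q : ℝ × ℝ => W' q.1 q.2) (Icc 0 1 ×ˢ Icc 0 1)) :
    cutNorm (fun x y => W x y - W' x y) ≤ ε := by
  refine csSup_le ⟨_, ∅, ∅, .empty, .empty, by simp, by simp, rfl⟩ ?_
  rintro _ ⟨S, T, hS, hT, hS1, hT1, rfl⟩
  rw [integral_sub (hW.mono_set (prod_mono hS1 hT1)) (hW'.mono_set (prod_mono hS1 hT1))]
  exact h S T hS hT hS1 hT1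

end StepKernels

section Density

lemma sum_adjWeight {n : ℕ} (p : ℝ) (G : SimpleGraph (Fin n)) (A B : Finset (Fin n)) :
    ∑ i ∈ A, ∑ j ∈ B, adjWeight p G i j = ePairs G A B / p := by
  rw [← Finset.sum_product' A B (adjWeight p G), ePairs]
  simp only [adjWeight]
  rw [← Finset.sum_filter, Finset.sum_const, nsmul_eq_mul, mul_one_div]

lemma ePairs_mono {n : ℕ} (G : SimpleGraph (Fin n)) {A A' B B' : Finset (Fin n)} (hA : A ⊆ A')
    (hB : B ⊆ B') : ePairs G A B ≤ ePairs G A' B' :=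
  Finset.card_le_card (Finset.filter_subset_filter _ (Finset.product_subset_product hA hB))

lemma ePairs_le_of_dDens_le {n : ℕ} {p D : ℝ} (hp : 0 < p) {G : SimpleGraph (Fin n)}
    {A B : Finset (Fin n)} (hA : 0 < A.card) (hB : 0 < B.card) (h : dDens p G A B ≤ D) :
    ePairs G A B / p ≤ D * A.card * B.card := by
  have hA' : (0 : ℝ) < A.card := by exact_mod_cast hA
  have hB' : (0 : ℝ) < B.card := by exact_mod_cast hB
  rw [dDens, div_le_iff₀ (by positivity)] at h
  rw [div_le_iff₀ hp]
  linarith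

lemma exists_superset_dense {n : ℕ} {ε : ℝ} (hε1 : ε ≤ 1) (hn : 1 ≤ ε * n)
    (A : Finset (Fin n)) (hA : A.card < ε * n) :
    ∃ A', A ⊆ A' ∧ ε * n ≤ A'.card ∧ (A'.card : ℝ) ≤ 2 * ε * n := by
  have h1 : A.card ≤ ⌈ε * n⌉₊ := by
    exact_mod_cast hA.le.trans (Nat.le_ceil _)
  have h2 : ⌈ε * n⌉₊ ≤ Fintype.card (Fin n) := by
    rw [Fintype.card_fin]
    exact Nat.ceil_le.2 (by nlinarith [(Nat.cast_nonneg n : (0 : ℝ) ≤ n)])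
  obtain ⟨A', hAA', hcard⟩ := Finset.exists_superset_card_eq h1 h2
  refine ⟨A', hAA', ?_, ?_⟩ <;> rw [hcard]
  · exact Nat.le_ceil _
  · have := Nat.ceil_lt_add_one (a := ε * n) (by linarith)
    linarith

lemma DensityBoundedBy.eventually_sum_adjWeight_le {p : ℕ → ℝ} (hp : ∀ n, 0 < p n)
    {C : ℝ} (hC : 0 < C) {G : ∀ n, SimpleGraph (Fin n)} (hden : DensityBoundedBy p G C)
    {η : ℝ} (hη : 0 < η) :
    ∀ᶠ n in atTop, ∀ A B : Finset (Fin n),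
      ∑ i ∈ A, ∑ j ∈ B, adjWeight (p n) (G n) i j ≤ C * A.card * B.card + η * (n : ℝ) ^ 2 := by
  set δ := min η 1 with hδ
  have hδ0 : 0 < δ := lt_min hη one_pos
  set ε := min (η / (2 * (C + 1))) 1 with hε
  have hε0 : 0 < ε := lt_min (by positivity) one_pos
  have hε1 : ε ≤ 1 := min_le_right _ _
  have hεη : 2 * ε * (C + δ) ≤ η := by
    have h1 : ε * (2 * (C + 1)) ≤ η := (le_div_iff₀ (by positivity)).1 (min_le_left _ _)
    have h2 : δ ≤ 1 := min_le_right _ _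
    nlinarith
  have hlarge : ∀ᶠ n : ℕ in atTop, 1 / ε ≤ n := tendsto_natCast_atTop_atTop.eventually_ge_atTop _
  filter_upwards [hden ε hε0 δ hδ0, hlarge] with n hn hn1 A B
  have hn1' : 1 ≤ ε * n := by rwa [div_le_iff₀' hε0] at hn1
  have hn0 : (0 : ℝ) < n := by
    by_contra h
    nlinarith
  rw [sum_adjWeight]
  have cardle : ∀ A : Finset (Fin n), (A.card : ℝ) ≤ n := fun A => by
    exact_mod_cast (Finset.card_le_univ A).trans_eq (Fintype.card_fin n)
  have pos : ∀ A : Finset (Fin n), ε * n ≤ A.card → 0 < A.card := fun A h => by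
    have : (0 : ℝ) < A.card := by linarith
    exact_mod_cast this
  have hmono : ∀ A' B' : Finset (Fin n), A ⊆ A' → B ⊆ B' →
      (ePairs (G n) A B : ℝ) / p n ≤ ePairs (G n) A' B' / p n := fun A' B' hA hB =>
    div_le_div_of_nonneg_right (by exact_mod_cast ePairs_mono (G n) hA hB) (hp n).le
  have hu : ε * n ≤ (Finset.univ : Finset (Fin n)).card := by
    rw [Finset.card_univ, Fintype.card_fin]
    nlinarith
  have hcu : ((Finset.univ : Finset (Fin n)).card : ℝ) = n := by simp
  have hCAB : 0 ≤ C * A.card * B.card := by positivity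
  by_cases hA : ε * n ≤ A.card
  · by_cases hB : ε * n ≤ B.card
    · have h := ePairs_le_of_dDens_le (hp n) (pos A hA) (pos B hB) (hn A B hA hB)
      have h1 : (A.card : ℝ) * B.card ≤ (n : ℝ) ^ 2 := by
        rw [sq]; exact mul_le_mul (cardle A) (cardle B) (by positivity) hn0.le
      have h2 : δ * (A.card * B.card) ≤ η * (n : ℝ) ^ 2 :=
        mul_le_mul (min_le_left _ _) h1 (by positivity) hη.le
      linarith
    · obtain ⟨B', hBB', h1, h2⟩ := exists_superset_dense hε1 hn1' B (not_le.1 hB)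
      have h := ePairs_le_of_dDens_le (hp n) (pos _ hu) (pos B' h1) (hn Finset.univ B' hu h1)
      have h3 := hmono _ _ (Finset.subset_univ A) hBB'
      rw [hcu] at h
      have h4 := mul_le_mul_of_nonneg_left h2 (by positivity : 0 ≤ (C + δ) * n)
      have h5 := mul_le_mul_of_nonneg_right hεη (sq_nonneg (n : ℝ))
      nlinarith
  · obtain ⟨A', hAA', h1, h2⟩ := exists_superset_dense hε1 hn1' A (not_le.1 hA)
    have h := ePairs_le_of_dDens_le (hp n) (pos A' h1) (pos _ hu) (hn A' Finset.univ h1 hu)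
    have h3 := hmono _ _ hAA' (Finset.subset_univ B)
    rw [hcu] at h
    have h4 := mul_le_mul_of_nonneg_left h2 (by positivity : 0 ≤ (C + δ) * n)
    have h5 := mul_le_mul_of_nonneg_right hεη (sq_nonneg (n : ℝ))
    nlinarith

end Density

section CellPermutation

variable {n : ℕ}

/-- The piecewise translation of the line permuting the `n` subintervals of `(0,1]`. -/
noncomputable def cellShift (π : Equiv.Perm (Fin n)) (x : ℝ) : ℝ :=
  x + ∑ i : Fin n, (cell n i).indicator (fun _ => ((π i : ℝ) - i) / n) x

lemma measurable_cellShift (π : Equiv.Perm (Fin n)) : Measurable (cellShift π) :=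
  measurable_id.add (Finset.measurable_sum _ fun i _ =>
    measurable_const.indicator (measurableSet_cell n i))

lemma exists_mem_cell (hn : 0 < n) {x : ℝ} (hx : x ∈ Ioc (0 : ℝ) 1) :
    ∃ i : Fin n, x ∈ cell n i :=
  ⟨⟨idx n x, idx_lt hn hx⟩, (mem_cell_iff hn hx.1 _).2 rfl⟩

lemma eq_of_mem_cell (hn : 0 < n) {x : ℝ} {i j : Fin n} (hi : x ∈ cell n i) (hj : x ∈ cell n j) :
    i = j := by
  have hx := (cell_subset i.2 hi).1
  exact Fin.ext (((mem_cell_iff hn hx _).1 hi).symm.trans ((mem_cell_iff hn hx _).1 hj))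

lemma cellShift_of_mem (hn : 0 < n) (π : Equiv.Perm (Fin n)) {x : ℝ} {i : Fin n}
    (hi : x ∈ cell n i) : cellShift π x = x + ((π i : ℝ) - i) / n := by
  rw [cellShift, Finset.sum_eq_single i, indicator_of_mem hi]
  · exact fun j _ hj => indicator_of_notMem (fun h => hj (eq_of_mem_cell hn h hi)) _
  · simp

lemma cellShift_of_notMem (π : Equiv.Perm (Fin n)) {x : ℝ} (hx : x ∉ Ioc (0 : ℝ) 1) :
    cellShift π x = x := by
  rw [cellShift, Finset.sum_eq_zero, add_zero]
  exact fun i _ => indicator_of_notMem (fun h => hx (cell_subset i.2 h)) _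

lemma add_mem_cell_iff (x : ℝ) (i j : Fin n) :
    x + ((j : ℝ) - i) / n ∈ cell n j ↔ x ∈ cell n i := by
  simp only [cell, mem_Ioc, sub_div, add_div]
  constructor <;> rintro ⟨h1, h2⟩ <;> constructor <;> linarith

lemma cellShift_mem_cell (hn : 0 < n) (π : Equiv.Perm (Fin n)) {x : ℝ} {i : Fin n}
    (hi : x ∈ cell n i) : cellShift π x ∈ cell n (π i) := by
  rw [cellShift_of_mem hn π hi]
  exact (add_mem_cell_iff x i (π i)).2 hi

lemma cellShift_symm_cellShift (hn : 0 < n) (π : Equiv.Perm (Fin n)) (x : ℝ) :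
    cellShift π.symm (cellShift π x) = x := by
  by_cases hx : x ∈ Ioc (0 : ℝ) 1
  · obtain ⟨i, hi⟩ := exists_mem_cell hn hx
    rw [cellShift_of_mem hn _ (cellShift_mem_cell hn π hi), cellShift_of_mem hn π hi]
    simp only [Equiv.symm_apply_apply]
    ring
  · rw [cellShift_of_notMem π hx, cellShift_of_notMem _ hx]

/-- `cellShift` as a measurable equivalence. -/
noncomputable def cellShiftEquiv (hn : 0 < n) (π : Equiv.Perm (Fin n)) : ℝ ≃ᵐ ℝ where
  toFun := cellShift π
  invFun := cellShift π.symm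
  left_inv := cellShift_symm_cellShift hn π
  right_inv := cellShift_symm_cellShift hn π.symm
  measurable_toFun := measurable_cellShift π
  measurable_invFun := measurable_cellShift π.symm

lemma volume_eq_add_sum_cell (hn : 0 < n) {E : Set ℝ} (hE : MeasurableSet E) :
    volume E = volume (E \ Ioc 0 1) + ∑ i : Fin n, volume (E ∩ cell n i) := by
  have hU : E ∩ Ioc 0 1 = ⋃ i : Fin n, E ∩ cell n i := by
    ext x
    simp only [mem_inter_iff, mem_iUnion]
    constructor
    · rintro ⟨h1, h2⟩
      obtain ⟨i, hi⟩ := exists_mem_cell hn h2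
      exact ⟨i, h1, hi⟩
    · rintro ⟨i, h1, h2⟩
      exact ⟨h1, cell_subset i.2 h2⟩
  rw [← measure_inter_add_sdiff E (measurableSet_Ioc : MeasurableSet (Ioc (0 : ℝ) 1)), hU,
    measure_iUnion, tsum_fintype, add_comm]
  · intro i j hij
    exact disjoint_left.2 fun x h1 h2 => hij (eq_of_mem_cell hn h1.2 h2.2)
  · exact fun i => hE.inter (measurableSet_cell n i)

lemma measurePreserving_cellShift (hn : 0 < n) (π : Equiv.Perm (Fin n)) :
    MeasurePreserving (cellShift π) volume volume := by
  refine ⟨measurable_cellShift π, Measure.ext fun E hE => ?_⟩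
  rw [Measure.map_apply (measurable_cellShift π) hE,
    volume_eq_add_sum_cell hn (measurable_cellShift π hE), volume_eq_add_sum_cell hn hE]
  congr 1
  · congr 1
    ext x
    simp only [Set.mem_sdiff, mem_preimage]
    refine and_congr_left fun hx => ?_
    rw [cellShift_of_notMem π hx]
  · rw [← Equiv.sum_comp π (fun i : Fin n => volume (E ∩ cell n i))]
    refine Finset.sum_congr rfl fun i _ => ?_
    rw [← measure_preimage_add_right volume (((π i : ℝ) - i) / n) (E ∩ cell n (π i))]
    congr 1
    ext x
    simp only [mem_inter_iff, mem_preimage, add_mem_cell_iff]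
    refine and_congr_left fun hx => ?_
    rw [cellShift_of_mem hn π hx]

lemma cellShift_mem_Icc_iff (hn : 0 < n) (π : Equiv.Perm (Fin n)) (x : ℝ) :
    cellShift π x ∈ Icc (0 : ℝ) 1 ↔ x ∈ Icc (0 : ℝ) 1 := by
  have key : ∀ (π : Equiv.Perm (Fin n)) (x : ℝ), x ∈ Icc (0 : ℝ) 1 →
      cellShift π x ∈ Icc (0 : ℝ) 1 := by
    intro π x hx
    by_cases hx' : x ∈ Ioc (0 : ℝ) 1
    · obtain ⟨i, hi⟩ := exists_mem_cell hn hx'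
      exact Ioc_subset_Icc_self (cell_subset (π i).2 (cellShift_mem_cell hn π hi))
    · rwa [cellShift_of_notMem π hx']
  refine ⟨fun h => ?_, key π x⟩
  have := key π.symm _ h
  rwa [cellShift_symm_cellShift hn] at this

lemma mpBij_cellShift (hn : 0 < n) (π : Equiv.Perm (Fin n)) : MPBij (cellShift π) := by
  refine ⟨?_, fun x hx => (cellShift_mem_Icc_iff hn π x).2 hx,
    (cellShiftEquiv hn π).injective.injOn, fun y hy => ?_⟩
  · have h := (measurePreserving_cellShift hn π).restrict_preimage
      (measurableSet_Icc : MeasurableSet (Icc (0 : ℝ) 1))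
    have e : cellShift π ⁻¹' Icc 0 1 = Icc 0 1 := by
      ext x; exact cellShift_mem_Icc_iff hn π x
    rwa [e] at h
  · exact ⟨cellShift π.symm y, (cellShift_mem_Icc_iff hn π.symm y).2 hy,
      cellShift_symm_cellShift hn π.symm y⟩

lemma stepKernel_comp_cellShift (hn : 0 < n) (π : Equiv.Perm (Fin n)) (A : Fin n → Fin n → ℝ)
    (x y : ℝ) : stepKernel A (cellShift π x) (cellShift π y) =
      stepKernel (fun i j => A (π i) (π j)) x y := by
  rw [stepKernel_eq_sum hn, stepKernel_eq_sum hn, ← Equiv.sum_comp π]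
  refine Finset.sum_congr rfl fun i _ => ?_
  rw [← Equiv.sum_comp π]
  refine Finset.sum_congr rfl fun j _ => ?_
  have key : ∀ (x : ℝ) (i : Fin n), cellShift π x ∈ cell n (π i) ↔ x ∈ cell n i := by
    intro x i
    refine ⟨fun h => ?_, cellShift_mem_cell hn π⟩
    have := cellShift_mem_cell hn π.symm h
    rwa [cellShift_symm_cellShift hn, Equiv.symm_apply_apply] at this
  simp only [indicator, mem_prod, key]

lemma CutClose.comp_cellShift (hn : 0 < n) (π : Equiv.Perm (Fin n)) {W W' : ℝ → ℝ → ℝ} {ε : ℝ}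
    (h : CutClose W W' ε) :
    CutClose (fun x y => W (cellShift π x) (cellShift π y))
      (fun x y => W' (cellShift π x) (cellShift π y)) ε := by
  intro S T hS hT hS1 hT1
  have hmp : MeasurePreserving (Prod.map (cellShift π) (cellShift π))
      (volume : Measure (ℝ × ℝ)) volume :=
    (measurePreserving_cellShift hn π).prod (measurePreserving_cellShift hn π)
  have hemb : MeasurableEmbedding (Prod.map (cellShift π) (cellShift π)) :=
    ((cellShiftEquiv hn π).prodCongr (cellShiftEquiv hn π)).measurableEmbedding
  have hpre : ∀ S : Set ℝ, cellShift π ⁻¹' (cellShift π.symm ⁻¹' S) = S := by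
    intro S
    ext x
    simp [cellShift_symm_cellShift hn]
  have key : ∀ W : ℝ → ℝ → ℝ, ∫ q in S ×ˢ T, W (cellShift π q.1) (cellShift π q.2) =
      ∫ q in (cellShift π.symm ⁻¹' S) ×ˢ (cellShift π.symm ⁻¹' T), W q.1 q.2 := by
    intro W
    rw [← hmp.setIntegral_preimage_emb hemb (fun q : ℝ × ℝ => W q.1 q.2),
      preimage_prod_map_prod, hpre, hpre]
    rfl
  rw [key, key]
  exact h _ _ (measurable_cellShift _ hS) (measurable_cellShift _ hT)
    (fun x hx => (cellShift_mem_Icc_iff hn π.symm x).1 (hS1 hx))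
    (fun x hx => (cellShift_mem_Icc_iff hn π.symm x).1 (hT1 hx))

end CellPermutation

section WeakLimit

/-- Weak compactness of the set of measurable functions with values in `[0, C]`. -/
lemma exists_weak_limit {α ι : Type*} [MeasurableSpace α] (μ : Measure α) [IsFiniteMeasure μ]
    {C : ℝ} (hC : 0 ≤ C) (l : Ultrafilter ι) (U : ι → α → ℝ) (hU : ∀ m, Measurable (U m))
    (hUC : ∀ m x, U m x ∈ Icc 0 C) :
    ∃ k : α → ℝ, Measurable k ∧ (∀ x, k x ∈ Icc 0 C) ∧ ∀ E, MeasurableSet E →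
      Tendsto (fun m => ∫ x in E, U m x ∂μ) l (nhds (∫ x in E, k x ∂μ)) := by
  have habs : ∀ m x, ‖U m x‖ ≤ C := fun m x => by
    rw [Real.norm_eq_abs, abs_of_nonneg (hUC m x).1]; exact (hUC m x).2
  have hmem : ∀ m, MemLp (U m) 2 μ := fun m =>
    MemLp.of_bound (hU m).aestronglyMeasurable C (.of_forall (habs m))
  have hInt : ∀ m, Integrable (U m) μ := fun m => (hmem m).integrable (by norm_num)
  let u : ι → Lp ℝ 2 μ := fun m => (hmem m).toLp
  let R : ℝ := (measureUnivNNReal μ : ℝ) ^ (2 : ℝ≥0∞).toReal⁻¹ * C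
  have huR : ∀ m, ‖u m‖ ≤ R := fun m => Lp.norm_le_of_ae_bound hC (by
    filter_upwards [(hmem m).coeFn_toLp] with x hx
    rw [hx]
    exact habs m x)
  let f : ι → WeakDual ℝ (Lp ℝ 2 μ) := fun m =>
    StrongDual.toWeakDual (InnerProductSpace.toDual ℝ (Lp ℝ 2 μ) (u m))
  have hball : ∀ m, f m ∈ WeakDual.toStrongDual ⁻¹'
      Metric.closedBall (0 : StrongDual ℝ (Lp ℝ 2 μ)) R := by
    intro m
    rw [mem_preimage, mem_closedBall_zero_iff]
    exact ((InnerProductSpace.toDual ℝ (Lp ℝ 2 μ)).norm_map (u m)).trans_le (huR m)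
  obtain ⟨ψ, -, hψ⟩ := (WeakDual.isCompact_closedBall (𝕜 := ℝ)
    (0 : StrongDual ℝ (Lp ℝ 2 μ)) R).ultrafilter_le_nhds' (l.map f)
      (Ultrafilter.mem_map.2 (univ_mem' hball))
  let k : Lp ℝ 2 μ := (InnerProductSpace.toDual ℝ (Lp ℝ 2 μ)).symm (WeakDual.toStrongDual ψ)
  have hk : Integrable k μ := (Lp.memLp k).integrable (by norm_num)
  have hlim : ∀ E, MeasurableSet E →
      Tendsto (fun m => ∫ x in E, U m x ∂μ) l (nhds (∫ x in E, k x ∂μ)) := by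
    intro E hE
    have h1 : Tendsto (fun m => f m (indicatorConstLp 2 hE (measure_ne_top μ E) 1)) l
        (nhds (ψ (indicatorConstLp 2 hE (measure_ne_top μ E) 1))) :=
      ((WeakDual.eval_continuous _).tendsto ψ).comp hψ
    have h2 : ψ (indicatorConstLp 2 hE (measure_ne_top μ E) 1) = ∫ x in E, k x ∂μ := by
      rw [← L2.inner_indicatorConstLp_one (𝕜 := ℝ) hE (measure_ne_top μ E), real_inner_comm]
      exact (InnerProductSpace.toDual_symm_apply).symm
    have h3 : ∀ m, f m (indicatorConstLp 2 hE (measure_ne_top μ E) 1) = ∫ x in E, U m x ∂μ := by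
      intro m
      have : f m (indicatorConstLp 2 hE (measure_ne_top μ E) 1) = ∫ x in E, u m x ∂μ := by
        rw [← L2.inner_indicatorConstLp_one (𝕜 := ℝ) hE (measure_ne_top μ E), real_inner_comm]
        rfl
      rw [this]
      exact integral_congr_ae (ae_restrict_of_ae (hmem m).coeFn_toLp)
    simpa only [h2, h3] using h1
  have h0 : 0 ≤ᵐ[μ] k := ae_nonneg_of_forall_setIntegral_nonneg hk fun E hE _ =>
    ge_of_tendsto' (hlim E hE) fun m => integral_nonneg fun x => (hUC m x).1
  have h1 : k ≤ᵐ[μ] fun _ => C := ae_le_of_forall_setIntegral_le hk (integrable_const C)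
    fun E hE _ => le_of_tendsto' (hlim E hE) fun m =>
      integral_mono (hInt m).restrict (integrable_const C) fun x => (hUC m x).2
  refine ⟨fun x => clip C (k x), ?_, fun x => clip_mem hC _, fun E hE => ?_⟩
  · exact measurable_const.max ((Lp.stronglyMeasurable k).measurable.min measurable_const)
  · have : ∫ x in E, clip C (k x) ∂μ = ∫ x in E, k x ∂μ := by
      refine integral_congr_ae (ae_restrict_of_ae ?_)
      filter_upwards [h0, h1] with x hx0 hx1
      simp only [clip, min_eq_left hx1]
      exact max_eq_right hx0
    rw [this]
    exact hlim E hE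

lemma integrableOn_of_mem_Icc {C : ℝ} {k : ℝ × ℝ → ℝ} (hk : Measurable k)
    (hkC : ∀ q, k q ∈ Icc 0 C) {S T : Set ℝ} (hS : S ⊆ Icc 0 1) (hT : T ⊆ Icc 0 1) :
    IntegrableOn k (S ×ˢ T) := by
  have h : IntegrableOn k (Icc 0 1 ×ˢ Icc 0 1) := by
    refine Measure.integrableOn_of_bounded (M := C) ?_ hk.aestronglyMeasurable
      (.of_forall fun q => ?_)
    · rw [Measure.volume_eq_prod, Measure.prod_prod]
      simp
    · rw [Real.norm_eq_abs, abs_of_nonneg (hkC q).1]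
      exact (hkC q).2
  exact h.mono_set (prod_mono hS hT)

/-- A sequence of symmetric functions that is asymptotically close in cut norm to all later members
of a sequence of functions with values in `[0, C]` has a limit in cut norm. -/
lemma exists_kernel_cutClose {C : ℝ} (hC : 0 ≤ C) (W U : ℕ → ℝ → ℝ → ℝ) (δ : ℕ → ℝ)
    (hW : ∀ m x y, W m x y = W m y x)
    (hU : ∀ m, Measurable fun q : ℝ × ℝ => U m q.1 q.2) (hUC : ∀ m x y, U m x y ∈ Icc 0 C)
    (hWU : ∀ m j, m ≤ j → CutClose (W m) (U j) (δ m)) :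
    ∃ κ, IsKernelBdd κ C ∧ ∀ m, CutClose (W m) κ (δ m) := by
  let μ : Measure (ℝ × ℝ) := volume.restrict (Icc 0 1 ×ˢ Icc 0 1)
  have hμ : IsFiniteMeasure μ := by
    refine isFiniteMeasure_restrict.2 ?_
    rw [Measure.volume_eq_prod, Measure.prod_prod]
    simp
  obtain ⟨k, hk, hkC, hlim⟩ := exists_weak_limit μ hC (hyperfilter ℕ)
    (fun m q => U m q.1 q.2) hU (fun m q => hUC m _ _)
  have hclose : ∀ m, CutClose (W m) (fun x y => k (x, y)) (δ m) := by
    intro m S T hS hT hS1 hT1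
    have hres : μ.restrict (S ×ˢ T) = volume.restrict (S ×ˢ T) := by
      rw [Measure.restrict_restrict (hS.prod hT),
        inter_eq_self_of_subset_left (prod_mono hS1 hT1)]
    have h := hlim _ (hS.prod hT)
    simp only [hres] at h
    refine le_of_tendsto ((tendsto_const_nhds.sub h).abs) ?_
    have hev : ∀ᶠ j in (hyperfilter ℕ : Filter ℕ), m ≤ j :=
      Nat.hyperfilter_le_atTop (eventually_ge_atTop m)
    filter_upwards [hev] with j hj
    exact hWU m j hj S T hS hT hS1 hT1
  have hswap : ∀ (f : ℝ → ℝ → ℝ) (S T : Set ℝ),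
      ∫ q in S ×ˢ T, f q.2 q.1 = ∫ q in T ×ˢ S, f q.1 q.2 := fun f S T =>
    setIntegral_prod_swap T S (fun q : ℝ × ℝ => f q.1 q.2)
  refine ⟨fun x y => (k (x, y) + k (y, x)) / 2, ⟨?_, fun x y => by dsimp only; ring, fun x y => ?_⟩,
    fun m S T hS hT hS1 hT1 => ?_⟩
  · exact (hk.add (hk.comp measurable_swap)).div_const 2
  · have h1 := hkC (x, y)
    have h2 := hkC (y, x)
    exact ⟨by linarith [h1.1, h2.1], by linarith [h1.2, h2.2]⟩
  · have e1 : ∫ q in S ×ˢ T, (k (q.1, q.2) + k (q.2, q.1)) / 2 =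
        ((∫ q in S ×ˢ T, k (q.1, q.2)) + ∫ q in T ×ˢ S, k (q.1, q.2)) / 2 := by
      rw [integral_div, integral_add, hswap (fun x y => k (x, y))]
      · exact integrableOn_of_mem_Icc hk hkC hS1 hT1
      · exact integrableOn_of_mem_Icc (hk.comp measurable_swap) (fun q => hkC _) hS1 hT1
    have e2 : ∫ q in T ×ˢ S, W m q.1 q.2 = ∫ q in S ×ˢ T, W m q.1 q.2 := by
      rw [← hswap (W m)]
      simp only [fun q : ℝ × ℝ => hW m q.2 q.1]
    have h1 := abs_le.1 (hclose m S T hS hT hS1 hT1)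
    have h2 := abs_le.1 (hclose m T S hT hS hT1 hS1)
    rw [e2] at h2
    rw [e1, abs_le]
    constructor <;> linarith [h1.1, h1.2, h2.1, h2.2]

end WeakLimit

section SortedColourings

/-- The points of `(0,1]` lying in a cell of colour at most `a`. -/
def sublevel {n : ℕ} (d : Fin n → ℕ) (a : ℕ) : Set ℝ :=
  {x | x ∈ Ioc (0 : ℝ) 1 ∧ ∃ h : idx n x < n, d ⟨idx n x, h⟩ ≤ a}

lemma idx_mono (n : ℕ) : Monotone (idx n) := fun x y hxy => by
  unfold idx
  gcongr

lemma sublevel_subset {n : ℕ} (d : Fin n → ℕ) (a : ℕ) : sublevel d a ⊆ Ioc 0 1 := fun _ hx => hx.1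

lemma mem_sublevel_of_le {n : ℕ} {d : Fin n → ℕ} (hd : Monotone d) {a : ℕ} {x y : ℝ}
    (hx : x ∈ sublevel d a) (hy : 0 < y) (hyx : y ≤ x) : y ∈ sublevel d a := by
  obtain ⟨hx1, h, hxa⟩ := hx
  have hi := idx_mono n hyx
  exact ⟨⟨hy, hyx.trans hx1.2⟩, hi.trans_lt h, (hd (by exact hi)).trans hxa⟩

lemma measurableSet_sublevel {n : ℕ} {d : Fin n → ℕ} (hd : Monotone d) (a : ℕ) :
    MeasurableSet (sublevel d a) :=
  OrdConnected.measurableSet ⟨fun _ hx _ hy _ hz =>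
    mem_sublevel_of_le hd hy (hx.1.1.trans_le hz.1) hz.2⟩

lemma volume_sublevel_ne_top {n : ℕ} (d : Fin n → ℕ) (a : ℕ) : volume (sublevel d a) ≠ ⊤ :=
  ((measure_mono (sublevel_subset d a)).trans_lt measure_Ioc_lt_top).ne

lemma volume_real_sublevel_mem {n : ℕ} (d : Fin n → ℕ) (a : ℕ) :
    volume.real (sublevel d a) ∈ Icc (0 : ℝ) 1 := by
  refine ⟨measureReal_nonneg, ?_⟩
  have h := measureReal_mono (μ := volume) (sublevel_subset d a) measure_Ioc_lt_top.ne
  simpa [Real.volume_real_Ioc] using h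

lemma sublevel_subset_or {n n' : ℕ} {d : Fin n → ℕ} {d' : Fin n' → ℕ} (hd : Monotone d)
    (hd' : Monotone d') (a : ℕ) :
    sublevel d a ⊆ sublevel d' a ∨ sublevel d' a ⊆ sublevel d a := by
  by_contra! h
  obtain ⟨⟨x, hx, hx'⟩, ⟨y, hy, hy'⟩⟩ := And.intro (not_subset.1 h.1) (not_subset.1 h.2)
  rcases le_total x y with hxy | hxy
  · exact hx' (mem_sublevel_of_le hd' hy hx.1.1 hxy)
  · exact hy' (mem_sublevel_of_le hd hx hy.1.1 hxy)

lemma volume_real_symmDiff_sublevel_le {n n' : ℕ} {d : Fin n → ℕ} {d' : Fin n' → ℕ}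
    (hd : Monotone d) (hd' : Monotone d') (a : ℕ) :
    volume.real (symmDiff (sublevel d a) (sublevel d' a)) ≤
      |volume.real (sublevel d a) - volume.real (sublevel d' a)| := by
  rcases sublevel_subset_or hd hd' a with h | h
  · rw [symmDiff_of_le h, measureReal_sdiff h (measurableSet_sublevel hd a)
      (volume_sublevel_ne_top d' a), abs_sub_comm]
    exact le_abs_self _
  · rw [symmDiff_of_ge h, measureReal_sdiff h (measurableSet_sublevel hd' a)
      (volume_sublevel_ne_top d a)]
    exact le_abs_self _

lemma colour_eq_of_notMem_symmDiff {n n' : ℕ} {d : Fin n → ℕ} {d' : Fin n' → ℕ} {L : ℕ}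
    (hL : ∀ i, d i < L) (hL' : ∀ i, d' i < L) {x : ℝ} (hx : x ∈ Ioc (0 : ℝ) 1)
    (h : idx n x < n) (h' : idx n' x < n')
    (hD : x ∉ ⋃ a ∈ Finset.range L, symmDiff (sublevel d a) (sublevel d' a)) :
    d ⟨idx n x, h⟩ = d' ⟨idx n' x, h'⟩ := by
  have key : ∀ a < L, (x ∈ sublevel d a ↔ x ∈ sublevel d' a) := by
    intro a ha
    simp only [mem_iUnion, Finset.mem_range, not_exists, Set.mem_symmDiff] at hD
    have := hD a ha
    tauto
  have e : ∀ a, x ∈ sublevel d a ↔ d ⟨idx n x, h⟩ ≤ a := fun a =>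
    ⟨fun hx => hx.2.2, fun ha => ⟨hx, h, ha⟩⟩
  have e' : ∀ a, x ∈ sublevel d' a ↔ d' ⟨idx n' x, h'⟩ ≤ a := fun a =>
    ⟨fun hx => hx.2.2, fun ha => ⟨hx, h', ha⟩⟩
  refine le_antisymm ?_ ?_
  · exact (e _).1 ((key _ (hL' _)).2 ((e' _).2 le_rfl))
  · exact (e' _).1 ((key _ (hL _)).1 ((e _).2 le_rfl))

lemma abs_sub_le_of_mem_Icc {C a b : ℝ} (ha : a ∈ Icc 0 C) (hb : b ∈ Icc 0 C) : |a - b| ≤ C :=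
  abs_le.2 ⟨by linarith [ha.1, hb.2], by linarith [ha.2, hb.1]⟩

lemma abs_stepKernel_sub_le {n n' : ℕ} (hn : 0 < n) (hn' : 0 < n') {d : Fin n → ℕ}
    {d' : Fin n' → ℕ} {D : Set ℝ} {C : ℝ} (hC : 0 ≤ C)
    {M : ℕ → ℕ → ℝ} (hM : ∀ a b, M a b ∈ Icc 0 C)
    (hD : ∀ x ∈ Ioc (0 : ℝ) 1, x ∉ D → ∀ (h : idx n x < n) (h' : idx n' x < n'),
      d ⟨idx n x, h⟩ = d' ⟨idx n' x, h'⟩) (x y : ℝ) :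
    |stepKernel (fun i j => M (d i) (d j)) x y - stepKernel (fun i j => M (d' i) (d' j)) x y| ≤
      (D ×ˢ Ioc 0 1).indicator (fun _ => C) (x, y) +
        (Ioc 0 1 ×ˢ D).indicator (fun _ => C) (x, y) := by
  have h0 : ∀ E : Set (ℝ × ℝ), 0 ≤ E.indicator (fun _ => C) (x, y) := fun E =>
    indicator_nonneg (fun _ _ => hC) _
  by_cases hx : x ∈ Ioc (0 : ℝ) 1
  · by_cases hy : y ∈ Ioc (0 : ℝ) 1
    · rw [stepKernel, stepKernel, dif_pos ⟨hx, hy, idx_lt hn hx, idx_lt hn hy⟩,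
        dif_pos ⟨hx, hy, idx_lt hn' hx, idx_lt hn' hy⟩]
      by_cases hxD : x ∈ D
      · rw [indicator_of_mem (mk_mem_prod hxD hy)]
        linarith [h0 (Ioc 0 1 ×ˢ D), abs_sub_le_of_mem_Icc
          (hM (d ⟨idx n x, idx_lt hn hx⟩) (d ⟨idx n y, idx_lt hn hy⟩))
          (hM (d' ⟨idx n' x, idx_lt hn' hx⟩) (d' ⟨idx n' y, idx_lt hn' hy⟩))]
      by_cases hyD : y ∈ D
      · rw [indicator_of_mem (mk_mem_prod hx hyD)]
        linarith [h0 (D ×ˢ Ioc 0 1), abs_sub_le_of_mem_Icc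
          (hM (d ⟨idx n x, idx_lt hn hx⟩) (d ⟨idx n y, idx_lt hn hy⟩))
          (hM (d' ⟨idx n' x, idx_lt hn' hx⟩) (d' ⟨idx n' y, idx_lt hn' hy⟩))]
      rw [hD x hx hxD (idx_lt hn hx) (idx_lt hn' hx), hD y hy hyD (idx_lt hn hy) (idx_lt hn' hy),
        sub_self, abs_zero]
      exact add_nonneg (h0 _) (h0 _)
    · rw [stepKernel, stepKernel, dif_neg fun h => hy h.2.1, dif_neg fun h => hy h.2.1,
        sub_self, abs_zero]
      exact add_nonneg (h0 _) (h0 _)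
  · rw [stepKernel, stepKernel, dif_neg fun h => hx h.1, dif_neg fun h => hx h.1,
      sub_self, abs_zero]
    exact add_nonneg (h0 _) (h0 _)

lemma cutClose_of_sublevel {n n' : ℕ} (hn : 0 < n) (hn' : 0 < n') {d : Fin n → ℕ}
    {d' : Fin n' → ℕ} (hd : Monotone d) (hd' : Monotone d') {L : ℕ} (hL : ∀ i, d i < L)
    (hL' : ∀ i, d' i < L) {C δ : ℝ} (hC : 0 ≤ C) {M : ℕ → ℕ → ℝ} (hM : ∀ a b, M a b ∈ Icc 0 C)
    (h : ∀ a < L, |volume.real (sublevel d a) - volume.real (sublevel d' a)| ≤ δ) :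
    CutClose (stepKernel fun i j => M (d i) (d j)) (stepKernel fun i j => M (d' i) (d' j))
      (2 * C * (L * δ)) := by
  set D := ⋃ a ∈ Finset.range L, symmDiff (sublevel d a) (sublevel d' a) with hDdef
  have hDm : MeasurableSet D := Finset.measurableSet_biUnion _ fun a _ =>
    (measurableSet_sublevel hd a).symmDiff (measurableSet_sublevel hd' a)
  have hD1 : D ⊆ Ioc 0 1 := iUnion₂_subset fun a _ => symmDiff_subset_union.trans
    (union_subset (sublevel_subset d a) (sublevel_subset d' a))
  have hDvol : volume.real D ≤ L * δ := by
    refine (measureReal_biUnion_finset_le _ _).trans ?_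
    refine (Finset.sum_le_sum fun a ha => (volume_real_symmDiff_sublevel_le hd hd' a).trans
      (h a (Finset.mem_range.1 ha))).trans ?_
    simp
  have hDtop : volume D ≠ ⊤ := ((measure_mono hD1).trans_lt measure_Ioc_lt_top).ne
  have hItop : volume (Ioc (0 : ℝ) 1) ≠ ⊤ := measure_Ioc_lt_top.ne
  have hInt : ∀ A B : Set ℝ, MeasurableSet A → MeasurableSet B → volume A ≠ ⊤ → volume B ≠ ⊤ →
      Integrable ((A ×ˢ B).indicator (fun _ : ℝ × ℝ => C)) := by
    intro A B hA hB hA' hB'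
    refine (integrable_indicator_iff (hA.prod hB)).2 (integrableOn_const ?_)
    rw [Measure.volume_eq_prod, Measure.prod_prod]
    exact ENNReal.mul_ne_top hA' hB'
  have hg1 := hInt D (Ioc 0 1) hDm measurableSet_Ioc hDtop hItop
  have hg2 := hInt (Ioc 0 1) D measurableSet_Ioc hDm hItop hDtop
  intro S T _ _ _ _
  rw [← integral_sub (integrable_stepKernel hn _).integrableOn
    (integrable_stepKernel hn' _).integrableOn, ← Real.norm_eq_abs]
  refine (norm_integral_le_of_norm_le (hg1.add hg2).integrableOn (.of_forall fun q => ?_)).trans ?_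
  · exact abs_stepKernel_sub_le hn hn' hC hM
      (fun x hx hxD hi hi' => colour_eq_of_notMem_symmDiff hL hL' hx hi hi' hxD) q.1 q.2
  · refine (setIntegral_le_integral (hg1.add hg2) (.of_forall fun q => ?_)).trans ?_
    · exact add_nonneg (indicator_nonneg (fun _ _ => hC) _) (indicator_nonneg (fun _ _ => hC) _)
    · rw [integral_add' hg1 hg2, integral_indicator_const _ (hDm.prod measurableSet_Ioc),
        integral_indicator_const _ (measurableSet_Ioc.prod hDm), Measure.volume_eq_prod,
        measureReal_prod_prod, measureReal_prod_prod, Real.volume_real_Ioc_of_le zero_le_one]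
      simp only [smul_eq_mul]
      nlinarith

end SortedColourings

section Refinement

/-- The successive common refinements of a sequence of colourings, coded in mixed radix. -/
def refinement {V : Type*} (K : ℕ → ℕ) (c : ℕ → V → ℕ) : ℕ → V → ℕ
  | 0 => fun _ => 0
  | m + 1 => fun i => refinement K c m i * K m + c m i

variable {V : Type*} {K : ℕ → ℕ} {c : ℕ → V → ℕ}

lemma refinement_succ_mod (hc : ∀ m i, c m i < K m) (m : ℕ) (i : V) :
    refinement K c (m + 1) i % K m = c m i := by
  change (refinement K c m i * K m + c m i) % K m = c m i
  rw [mul_comm, Nat.mul_add_mod, Nat.mod_eq_of_lt (hc m i)]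

lemma refinement_succ_div (hc : ∀ m i, c m i < K m) (m : ℕ) (i : V) :
    refinement K c (m + 1) i / K m = refinement K c m i := by
  change (refinement K c m i * K m + c m i) / K m = refinement K c m i
  rw [mul_comm, Nat.mul_add_div ((Nat.zero_le _).trans_lt (hc m i)),
    Nat.div_eq_of_lt (hc m i), add_zero]

lemma refinement_lt (hc : ∀ m i, c m i < K m) (m : ℕ) (i : V) :
    refinement K c m i < ∏ j ∈ Finset.range m, K j := by
  induction m with
  | zero => simp [refinement]
  | succ m ih =>
    rw [Finset.prod_range_succ, refinement]
    nlinarith [hc m i]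

lemma monotone_refinement_comp {n : ℕ} (hc : ∀ m i, c m i < K m) (σ : Fin n → V) {m N : ℕ}
    (hmN : m ≤ N) (hN : Monotone (refinement K c N ∘ σ)) : Monotone (refinement K c m ∘ σ) := by
  induction N, hmN using Nat.le_induction with
  | base => exact hN
  | succ N _ ih =>
    refine ih fun i j hij => ?_
    have h := Nat.div_le_div_right (c := K N) (hN hij)
    simpa only [Function.comp_apply, refinement_succ_div hc] using h

end Refinement

section SortedApproximation

lemma adjWeight_comap {n : ℕ} (p : ℝ) (G : SimpleGraph (Fin n)) (σ : Equiv.Perm (Fin n)) :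
    adjWeight p (G.comap σ) = fun i j => adjWeight p G (σ i) (σ j) := rfl

lemma cutClose_graphKernel_comap {n : ℕ} (hn : 0 < n) {p ε : ℝ} {G : SimpleGraph (Fin n)}
    {B : Fin n → Fin n → ℝ} (σ : Equiv.Perm (Fin n))
    (h : ∀ S T : Finset (Fin n),
      |∑ i ∈ S, ∑ j ∈ T, (adjWeight p G i j - B i j)| ≤ ε * (n : ℝ) ^ 2) :
    CutClose (graphKernel p (G.comap σ)) (stepKernel fun i j => B (σ i) (σ j)) ε := by
  rw [graphKernel_eq_stepKernel]
  refine cutClose_stepKernel hn fun S T => ?_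
  simpa only [Finset.sum_map, adjWeight_comap, Equiv.coe_toEmbedding] using
    h (S.map σ.toEmbedding) (T.map σ.toEmbedding)

/-- After a relabelling that does not depend on the precision, each graph in a sequence of bounded
density is approximated, at every precision, by a step kernel coming from a monotone colouring and
one of finitely many matrices. -/
lemma exists_sorted_approximation {p : ℕ → ℝ} (hp : ∀ n, 0 < p n) {C : ℝ} (hC : 0 < C)
    {G : ∀ n, SimpleGraph (Fin n)} (hden : DensityBoundedBy p G C) {ε : ℕ → ℝ}
    (hε : ∀ m, 0 < ε m) :
    ∃ (σ : ∀ n, Equiv.Perm (Fin n)) (L : ℕ → ℕ) (F : ℕ → Set (ℕ → ℕ → ℝ))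
      (d : ∀ _ n : ℕ, Fin n → ℕ) (M : ℕ → ℕ → ℕ → ℕ → ℝ),
      (∀ m, (F m).Finite) ∧ (∀ m, ∀ N ∈ F m, ∀ a b, N a b ∈ Icc 0 C) ∧
      ∀ m, ∀ᶠ n in atTop, 0 < n ∧ Monotone (d m n) ∧ (∀ i, d m n i < L m) ∧ M m n ∈ F m ∧
        CutClose (graphKernel (p n) ((G n).comap (σ n)))
          (stepKernel fun i j => M m n (d m n i) (d m n j)) (ε m) := by
  choose K hK F hF hFC η hη hreg using fun m => exists_weak_regularity hC.le (hε m)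
  have hcol : ∀ n m, ∃ c : Fin n → ℕ, ∃ N : ℕ → ℕ → ℝ, (∀ i, c i < K m) ∧
      (0 < n → (∀ A B : Finset (Fin n), ∑ i ∈ A, ∑ j ∈ B, adjWeight (p n) (G n) i j ≤
        C * A.card * B.card + η m * (n : ℝ) ^ 2) → N ∈ F m ∧
        ∀ S T : Finset (Fin n), |∑ i ∈ S, ∑ j ∈ T, (adjWeight (p n) (G n) i j - N (c i) (c j))| ≤
          ε m * (n : ℝ) ^ 2) := by
    intro n m
    by_cases h : 0 < n ∧ ∀ A B : Finset (Fin n), ∑ i ∈ A, ∑ j ∈ B, adjWeight (p n) (G n) i j ≤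
        C * A.card * B.card + η m * (n : ℝ) ^ 2
    · obtain ⟨c, hc, N, hN, hcut⟩ := hreg m n h.1 (adjWeight (p n) (G n))
        (fun i j => by
          unfold adjWeight
          split_ifs
          exacts [(one_div_pos.2 (hp n)).le, le_rfl]) h.2
      exact ⟨c, N, hc, fun _ _ => ⟨hN, hcut⟩⟩
    · exact ⟨fun _ => 0, 0, fun _ => hK m, fun h1 h2 => absurd ⟨h1, h2⟩ h⟩
  choose c N hc hN using hcol
  refine ⟨fun n => Tuple.sort (refinement K (c n) n), fun m => ∏ j ∈ Finset.range (m + 1), K j,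
    fun m => (fun N a b => N (a % K m) (b % K m)) '' F m,
    fun m n => refinement K (c n) (m + 1) ∘ Tuple.sort (refinement K (c n) n),
    fun m n a b => N n m (a % K m) (b % K m), fun m => (hF m).image _, ?_, fun m => ?_⟩
  · rintro m _ ⟨N, hN, rfl⟩ a b
    exact hFC m N hN _ _
  · filter_upwards [hden.eventually_sum_adjWeight_le hp hC (hη m), eventually_gt_atTop m]
      with n hn hmn
    obtain ⟨h1, h2⟩ := hN n m (by omega) hn
    refine ⟨by omega, monotone_refinement_comp (hc n) _ hmn (Tuple.monotone_sort _),
      fun i => refinement_lt (hc n) _ _, mem_image_of_mem _ h1, ?_⟩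
    simp only [Function.comp_apply, refinement_succ_mod (hc n)]
    exact cutClose_graphKernel_comap (by omega) _ h2

end SortedApproximation

section Compactness

lemma exists_ultrafilter_cutClose (𝒰 : Ultrafilter ℕ) {L : ℕ} {F : Set (ℕ → ℕ → ℝ)}
    (hF : F.Finite) {C ε : ℝ} (hC : 0 < C) (hFC : ∀ N ∈ F, ∀ a b, N a b ∈ Icc 0 C) (hε : 0 < ε)
    {d : ∀ n : ℕ, Fin n → ℕ} {M : ℕ → ℕ → ℕ → ℝ}
    (h : ∀ᶠ n in (𝒰 : Filter ℕ), 0 < n ∧ Monotone (d n) ∧ (∀ i, d n i < L) ∧ M n ∈ F) :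
    ∃ A ∈ 𝒰, ∀ n ∈ A, ∀ n' ∈ A, CutClose (stepKernel fun i j => M n (d n i) (d n j))
      (stepKernel fun i j => M n' (d n' i) (d n' j)) ε := by
  obtain ⟨N, hNF, hN⟩ : ∃ N ∈ F, ∀ᶠ n in (𝒰 : Filter ℕ), M n = N :=
    (Ultrafilter.eventually_exists_mem_iff hF).1 (h.mono fun n hn => ⟨M n, hn.2.2.2, rfl⟩)
  have hlim : ∀ a, ∃ v, Tendsto (fun n => volume.real (sublevel (d n) a)) 𝒰 (nhds v) := by
    intro a
    obtain ⟨v, -, hv⟩ := (isCompact_Icc (a := (0 : ℝ)) (b := 1)).ultrafilter_le_nhds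
      (𝒰.map fun n : ℕ => volume.real (sublevel (d n) a))
      (le_principal_iff.2 (Filter.mem_map.2
        (Filter.univ_mem' fun n => volume_real_sublevel_mem (d n) a)))
    exact ⟨v, hv⟩
  choose v hv using hlim
  set δ := ε / (4 * C * (L + 1)) with hδ
  have hδ0 : 0 < δ := by positivity
  have hclose : ∀ᶠ n in (𝒰 : Filter ℕ), ∀ a ∈ Finset.range L,
      |volume.real (sublevel (d n) a) - v a| < δ :=
    (Finset.eventually_all _).2 fun a _ => (hv a).eventually (Metric.ball_mem_nhds (v a) hδ0)
  refine ⟨_, h.and (hN.and hclose), ?_⟩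
  rintro n ⟨⟨hn, hd, hL, -⟩, hM, hv⟩ n' ⟨⟨hn', hd', hL', -⟩, hM', hv'⟩
  rw [hM, hM']
  refine (cutClose_of_sublevel hn hn' hd hd' hL hL' hC.le (hFC N hNF) (δ := 2 * δ)
    fun a ha => ?_).mono ?_
  · have h1 := hv a (Finset.mem_range.2 ha)
    have h2 := hv' a (Finset.mem_range.2 ha)
    rw [abs_lt] at h1 h2
    exact abs_le.2 ⟨by linarith, by linarith⟩
  · have e : 2 * C * ((L + 1) * (2 * δ)) = ε := by
      rw [hδ]; field_simp; ring
    rw [← e]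
    gcongr
    linarith

lemma integrable_graphKernel {n : ℕ} (hn : 0 < n) (p : ℝ) (G : SimpleGraph (Fin n)) :
    Integrable (fun q : ℝ × ℝ => graphKernel p G q.1 q.2) :=
  integrable_stepKernel hn (adjWeight p G)

lemma graphKernel_symm {n : ℕ} (p : ℝ) (G : SimpleGraph (Fin n)) (x y : ℝ) :
    graphKernel p G x y = graphKernel p G y x := by
  unfold graphKernel
  by_cases h : x ∈ Ioc (0:ℝ) 1 ∧ y ∈ Ioc (0:ℝ) 1 ∧ idx n x < n ∧ idx n y < n
  · rw [dif_pos h, dif_pos ⟨h.2.1, h.1, h.2.2.2, h.2.2.1⟩]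
    exact if_congr (G.adj_comm _ _) rfl rfl
  · rw [dif_neg h, dif_neg fun h' => h ⟨h'.2.1, h'.1, h'.2.2.2, h'.2.2.1⟩]

lemma stepKernel_mem_Icc {n : ℕ} {A : Fin n → Fin n → ℝ} {C : ℝ} (hC : 0 ≤ C)
    (hA : ∀ i j, A i j ∈ Icc 0 C) (x y : ℝ) : stepKernel A x y ∈ Icc 0 C := by
  unfold stepKernel
  split_ifs
  exacts [hA _ _, ⟨le_rfl, hC⟩]

lemma cutDist_nonneg (κ₁ κ₂ : ℝ → ℝ → ℝ) : 0 ≤ cutDist κ₁ κ₂ :=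
  Real.sInf_nonneg (by rintro _ ⟨τ, -, rfl⟩; exact cutNorm_nonneg _)

lemma cutDist_le {κ₁ κ₂ : ℝ → ℝ → ℝ} {τ : ℝ → ℝ} (hτ : MPBij τ) :
    cutDist κ₁ κ₂ ≤ cutNorm (fun x y => κ₁ x y - κ₂ (τ x) (τ y)) :=
  csInf_le ⟨0, by rintro _ ⟨τ, -, rfl⟩; exact cutNorm_nonneg _⟩ ⟨τ, hτ, rfl⟩

lemma IsKernelBdd.integrableOn_comp {κ : ℝ → ℝ → ℝ} {C : ℝ} (hκ : IsKernelBdd κ C) {τ : ℝ → ℝ}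
    (hτ : Measurable τ) :
    IntegrableOn (fun q : ℝ × ℝ => κ (τ q.1) (τ q.2)) (Icc 0 1 ×ˢ Icc 0 1) :=
  integrableOn_of_mem_Icc (hκ.1.comp ((hτ.comp measurable_fst).prodMk (hτ.comp measurable_snd)))
    (fun _ => hκ.2.2 _ _) Subset.rfl Subset.rfl

lemma cutDist_graphKernel_le {n : ℕ} (hn : 0 < n) {p C ε : ℝ} {G : SimpleGraph (Fin n)}
    (σ : Equiv.Perm (Fin n)) {κ : ℝ → ℝ → ℝ} (hκ : IsKernelBdd κ C)
    (h : CutClose (graphKernel p (G.comap σ)) κ ε) : cutDist (graphKernel p G) κ ≤ ε := by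
  have hW : (fun x y => graphKernel p (G.comap σ) (cellShift σ.symm x) (cellShift σ.symm y)) =
      graphKernel p G := by
    funext x y
    rw [graphKernel_eq_stepKernel, stepKernel_comp_cellShift hn, graphKernel_eq_stepKernel]
    simp only [adjWeight_comap, Equiv.apply_symm_apply]
  have h' := h.comp_cellShift hn σ.symm
  rw [hW] at h'
  exact (cutDist_le (mpBij_cellShift hn σ.symm)).trans (h'.cutNorm_le
    (integrable_graphKernel hn p G).integrableOn
    (hκ.integrableOn_comp (measurable_cellShift σ.symm)))

lemma exists_strictMono_cutClose {p : ℕ → ℝ} (hp : ∀ n, 0 < p n) {C : ℝ} (hC : 0 < C)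
    {G : ∀ n, SimpleGraph (Fin n)} (hden : DensityBoundedBy p G C) {ε : ℕ → ℝ}
    (hε : ∀ m, 0 < ε m) (hanti : Antitone ε) :
    ∃ (σ : ∀ n, Equiv.Perm (Fin n)) (κ : ℝ → ℝ → ℝ) (φ : ℕ → ℕ), IsKernelBdd κ C ∧
      StrictMono φ ∧ ∀ m, 0 < φ m ∧
        CutClose (graphKernel (p (φ m)) ((G (φ m)).comap (σ (φ m)))) κ (4 * ε m) := by
  obtain ⟨σ, L, F, d, M, hF, hFC, happ⟩ := exists_sorted_approximation hp hC hden hε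
  have happ' := fun m => (happ m).filter_mono (Nat.hyperfilter_le_atTop)
  choose A hA hAclose using fun m => exists_ultrafilter_cutClose (hyperfilter ℕ) (hF m) hC (hFC m)
    (hε m) ((happ' m).mono fun n hn => ⟨hn.1, hn.2.1, hn.2.2.1, hn.2.2.2.1⟩)
  have hfreq : ∀ m, ∃ᶠ n in atTop, ∀ j ∈ Finset.range (m + 1), n ∈ A j ∧ 0 < n ∧ M j n ∈ F j ∧
      CutClose (graphKernel (p n) ((G n).comap (σ n)))
        (stepKernel fun i k => M j n (d j n i) (d j n k)) (ε j) := by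
    intro m
    have hev : ∀ᶠ n in (hyperfilter ℕ : Filter ℕ), ∀ j ∈ Finset.range (m + 1),
        n ∈ A j ∧ 0 < n ∧ M j n ∈ F j ∧ CutClose (graphKernel (p n) ((G n).comap (σ n)))
          (stepKernel fun i k => M j n (d j n i) (d j n k)) (ε j) :=
      (Finset.eventually_all _).2 fun j _ => by
        filter_upwards [hA j, happ' j] with n h1 h2
        exact ⟨h1, h2.1, h2.2.2.2.1, h2.2.2.2.2⟩
    exact hev.frequently.filter_mono Nat.hyperfilter_le_atTop
  obtain ⟨φ, hφ, hφA⟩ := extraction_forall_of_frequently hfreq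
  have hmem : ∀ m j, m ≤ j → m ∈ Finset.range (j + 1) := fun m j h =>
    Finset.mem_range.2 (by omega)
  obtain ⟨κ, hκ, hclose⟩ := exists_kernel_cutClose hC.le
    (fun m => graphKernel (p (φ m)) ((G (φ m)).comap (σ (φ m))))
    (fun j => stepKernel fun i k => M j (φ j) (d j (φ j) i) (d j (φ j) k)) (fun m => 4 * ε m)
    (fun m x y => graphKernel_symm _ _ _ _)
    (fun j => measurable_stepKernel (hφA j j (hmem j j le_rfl)).2.1 _)
    (fun j x y => stepKernel_mem_Icc hC.le
      (fun _ _ => hFC j _ (hφA j j (hmem j j le_rfl)).2.2.1 _ _) x y)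
    (fun m j hmj => by
      obtain ⟨h1, -, -, h2⟩ := hφA m m (hmem m m le_rfl)
      obtain ⟨h3, -, -, h4⟩ := hφA j m (hmem m j hmj)
      obtain ⟨-, -, -, h5⟩ := hφA j j (hmem j j le_rfl)
      refine (((h2.trans (hAclose m _ h1 _ h3)).trans h4.symm).trans h5).mono ?_
      linarith [hanti hmj])
  exact ⟨σ, κ, φ, hκ, hφ, fun m => ⟨(hφA m m (hmem m m le_rfl)).2.1, hclose m⟩⟩

end Compactness

/-- Any sequence of graphs with density bounded by `C` has a
subsequence converging in cut distance to a kernel with values in `[0,C]`; moreover,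
after relabelling the vertices, convergence holds in the cut norm itself. -/
theorem subsequence_cut_convergence (p : ℕ → ℝ) (hp : ∀ n, p n ∈ Ioc (0:ℝ) 1)
    (C : ℝ) (hC : 0 < C) (G : ∀ n, SimpleGraph (Fin n))
    (hden : DensityBoundedBy p G C) :
    ∃ κ : ℝ → ℝ → ℝ, IsKernelBdd κ C ∧
      ∃ φ : ℕ → ℕ, StrictMono φ ∧
        Tendsto (fun i => cutDist (graphKernel (p (φ i)) (G (φ i))) κ) atTop (nhds 0) ∧
        ∃ H : ∀ i, SimpleGraph (Fin (φ i)),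
          (∀ i, Nonempty ((H i) ≃g (G (φ i)))) ∧
          Tendsto (fun i => cutNorm (fun x y => graphKernel (p (φ i)) (H i) x y - κ x y))
            atTop (nhds 0) := by
  obtain ⟨σ, κ, φ, hκ, hφ, hclose⟩ := exists_strictMono_cutClose (fun n => (hp n).1) hC hden
    (ε := fun m : ℕ => 1 / ((m : ℝ) + 1)) (fun m => Nat.one_div_pos_of_nat)
    (fun m j h => Nat.one_div_le_one_div h)
  have hlim : Tendsto (fun m : ℕ => 4 * (1 / ((m : ℝ) + 1))) atTop (nhds 0) := by
    simpa using tendsto_one_div_add_atTop_nhds_zero_nat.const_mul (4 : ℝ)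
  refine ⟨κ, hκ, φ, hφ, ?_, fun i => (G (φ i)).comap (σ (φ i)),
    fun i => ⟨SimpleGraph.Iso.comap (σ (φ i)) (G (φ i))⟩, ?_⟩
  · exact squeeze_zero (fun i => cutDist_nonneg _ _)
      (fun i => cutDist_graphKernel_le (hclose i).1 (σ (φ i)) hκ (hclose i).2) hlim
  · exact squeeze_zero (fun i => cutNorm_nonneg _) (fun i => (hclose i).2.cutNorm_le
      (integrable_graphKernel (hclose i).1 _ _).integrableOn
      (hκ.integrableOn_comp measurable_id)) hlim
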